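/- arXiv:1705.10704 — 2 statements merged into one kernel-verified Lean document; each statement's English description precedes it below -/
import Mathlib

section
/- Fix λ ∈ (0,1), set α₀ = (1−λ)/(1+λ), and fix β ∈ (α₀, 1). Then there exist a constant M > 0 and an integer N such that for all n ≥ N and every integer k with k/n ∈ (α₀ + n^{−2/3}, β] ∪ [β^{−1}, α₀^{−1} − n^{−2/3}), one has |c_{n,k}| ≤ M · n^{−1/2} · (k/n − α₀)^{1/4} · (α₀^{−1} − k/n)^{1/4}. -/
theorem hasDerivAt_sin_div_cos_sub {x₀ t : ℝ} (ht : Real.cos t ≠ x₀) :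
    HasDerivAt (fun t => Real.sin t / (Real.cos t - x₀))
      ((1 - x₀ * Real.cos t) / (Real.cos t - x₀) ^ 2) t := by
  have h0 : Real.cos t - x₀ ≠ 0 := sub_ne_zero.mpr ht
  refine ((Real.hasDerivAt_sin t).fun_div ((Real.hasDerivAt_cos t).sub_const x₀) h0).congr_deriv ?_
  congr 1
  linear_combination Real.sin_sq_add_cos_sq t

/-- First-derivative test away from the stationary point `cos t = x₀`. -/
theorem norm_integral_sin_mul_le_of_cos_ne {B x₀ : ℝ} (hB : 1 < B) (hx₀ : |x₀| < 1) {μ : ℂ}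
    (hμ : μ ≠ 0) {E : ℝ → ℂ} (hE : ∀ t, ‖E t‖ ≤ 1)
    (hE' : ∀ t, HasDerivAt E
      (μ * ((Real.cos t - x₀) / (B - Real.cos t) : ℝ) * E t) t)
    {p q : ℝ} (hp : 0 ≤ p) (hpq : p ≤ q) (hq : q ≤ Real.pi)
    (hcos : ∀ t ∈ Set.Icc p q, Real.cos t ≠ x₀) :
    ‖∫ t in p..q, (Real.sin t : ℂ) * E t‖ ≤ (2 * (B + 1) + Real.pi) / ‖μ‖ *
      (|Real.sin p / (Real.cos p - x₀)| + |Real.sin q / (Real.cos q - x₀)|) := by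
  set R : ℝ → ℝ := fun t => Real.sin t / (Real.cos t - x₀) with hR
  set R' : ℝ → ℝ := fun t => (1 - x₀ * Real.cos t) / (Real.cos t - x₀) ^ 2 with hR'
  set S := |R p| + |R q| with hS
  change _ ≤ _ * S
  have hBc : ∀ t, 0 < B - Real.cos t := fun t => by linarith [Real.cos_le_one t]
  have hsub : ∀ t ∈ Set.Icc p q, Real.cos t - x₀ ≠ 0 := fun t ht => sub_ne_zero.mpr (hcos t ht)
  have hRd : ∀ t ∈ Set.Icc p q, HasDerivAt R (R' t) t :=
    fun t ht => hasDerivAt_sin_div_cos_sub (hcos t ht)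
  have hRc : ContinuousOn R (Set.Icc p q) := fun t ht => (hRd t ht).continuousAt.continuousWithinAt
  have hR'c : ContinuousOn R' (Set.Icc p q) := by
    apply ContinuousOn.div (by fun_prop) (by fun_prop)
    exact fun t ht => pow_ne_zero 2 (hsub t ht)
  have hR'0 : ∀ t, 0 ≤ R' t := fun t => by
    have h1 : |x₀ * Real.cos t| ≤ 1 := by
      rw [abs_mul]
      exact mul_le_one₀ hx₀.le (abs_nonneg _) (Real.abs_cos_le_one t)
    have := (abs_le.mp h1).2
    apply div_nonneg _ (sq_nonneg _)
    linarith
  have hmono : MonotoneOn R (Set.Icc p q) := by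
    apply monotoneOn_of_deriv_nonneg (convex_Icc p q) hRc
    · intro t ht
      exact (hRd t (interior_subset ht)).differentiableAt.differentiableWithinAt
    · intro t ht
      rw [(hRd t (interior_subset ht)).deriv]
      exact hR'0 t
  have hRS : ∀ t ∈ Set.Icc p q, |R t| ≤ S := fun t ht => by
    have h1 := hmono (Set.left_mem_Icc.mpr hpq) ht ht.1
    have h2 := hmono ht (Set.right_mem_Icc.mpr hpq) ht.2
    rw [abs_le]
    constructor <;>
      linarith [neg_abs_le (R p), le_abs_self (R q), abs_nonneg (R p), abs_nonneg (R q)]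
  have hR'i : ∫ t in p..q, R' t = R q - R p := by
    apply intervalIntegral.integral_eq_sub_of_hasDerivAt
    · rw [Set.uIcc_of_le hpq]; exact hRd
    · apply ContinuousOn.intervalIntegrable; rwa [Set.uIcc_of_le hpq]
  have hR'iS : ∫ t in p..q, R' t ≤ S := by
    rw [hR'i]; linarith [neg_abs_le (R p), le_abs_self (R q)]
  set V : ℝ → ℝ := fun t => (B - Real.cos t) * R t with hV
  set V' : ℝ → ℝ := fun t => Real.sin t * R t + (B - Real.cos t) * R' t with hV'
  have hVd : ∀ t ∈ Set.Icc p q, HasDerivAt V (V' t) t := fun t ht => by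
    refine (((Real.hasDerivAt_cos t).const_sub B).fun_mul (hRd t ht)).congr_deriv ?_
    simp only [hV']
    ring
  have hV'c : ContinuousOn V' (Set.Icc p q) := by
    have := hR'c
    fun_prop
  have hEc : Continuous E := continuous_iff_continuousAt.mpr fun t => (hE' t).continuousAt
  have hwc : Continuous (fun t => (Real.cos t - x₀) / (B - Real.cos t)) :=
    Continuous.div (by fun_prop) (by fun_prop) fun t => (hBc t).ne'
  have ibp := intervalIntegral.integral_mul_deriv_eq_deriv_mul (a := p) (b := q)
    (u := fun t => (V t : ℂ)) (u' := fun t => (V' t : ℂ)) (v := E)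
    (v' := fun t => μ * ((Real.cos t - x₀) / (B - Real.cos t) : ℝ) * E t)
    (by rw [Set.uIcc_of_le hpq]; exact fun t ht => (hVd t ht).ofReal_comp)
    (fun t _ => hE' t)
    (by
      apply ContinuousOn.intervalIntegrable; rw [Set.uIcc_of_le hpq]
      exact Complex.continuous_ofReal.comp_continuousOn hV'c)
    (by
      apply Continuous.intervalIntegrable
      exact (continuous_const.mul (Complex.continuous_ofReal.comp hwc)).mul hEc)
  have hlhs : ∫ t in p..q, (V t : ℂ) * (μ * ((Real.cos t - x₀) / (B - Real.cos t) : ℝ) * E t) =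
      μ * ∫ t in p..q, (Real.sin t : ℂ) * E t := by
    rw [← intervalIntegral.integral_const_mul]
    apply intervalIntegral.integral_congr
    intro t ht
    rw [Set.uIcc_of_le hpq] at ht
    have h1 : V t * ((Real.cos t - x₀) / (B - Real.cos t)) = Real.sin t := by
      have := hsub t ht
      have := (hBc t).ne'
      simp only [hV, hR]
      field_simp
    have h2 := congrArg (fun x : ℝ => (x : ℂ)) h1
    simp only [Complex.ofReal_mul] at h2
    simp only
    rw [← h2]
    ring
  rw [hlhs] at ibp
  have hμ0 : 0 < ‖μ‖ := norm_pos_iff.mpr hμ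
  have hbd : ∀ t ∈ Set.Icc p q, ‖(V t : ℂ) * E t‖ ≤ (B + 1) * |R t| := fun t ht => by
    rw [norm_mul, Complex.norm_real, Real.norm_eq_abs, hV, abs_mul, abs_of_pos (hBc t)]
    have h1 : (B - Real.cos t) * |R t| ≤ (B + 1) * |R t| := by
      gcongr; linarith [Real.neg_one_le_cos t]
    have h2 : 0 ≤ (B - Real.cos t) * |R t| := mul_nonneg (hBc t).le (abs_nonneg _)
    nlinarith [hE t, norm_nonneg (E t)]
  have hint : ‖∫ t in p..q, (V' t : ℂ) * E t‖ ≤ (Real.pi + B + 1) * S := by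
    have hS0 : 0 ≤ S := by positivity
    calc ‖∫ t in p..q, (V' t : ℂ) * E t‖ ≤ ∫ t in p..q, (S + (B + 1) * R' t) := by
          apply intervalIntegral.norm_integral_le_of_norm_le hpq
          · refine Filter.Eventually.of_forall fun t ht => ?_
            have ht := Set.Ioc_subset_Icc_self ht
            rw [norm_mul, Complex.norm_real, Real.norm_eq_abs]
            have h1 : |V' t| ≤ S + (B + 1) * R' t := by
              refine (abs_add_le _ _).trans (add_le_add ?_ ?_)
              · rw [abs_mul]
                nlinarith [Real.abs_sin_le_one t, hRS t ht, abs_nonneg (R t)]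
              · rw [abs_mul, abs_of_pos (hBc t), abs_of_nonneg (hR'0 t)]
                have := hR'0 t
                gcongr; linarith [Real.neg_one_le_cos t]
            nlinarith [hE t, norm_nonneg (E t), abs_nonneg (V' t)]
          · apply ContinuousOn.intervalIntegrable; rw [Set.uIcc_of_le hpq]; fun_prop
      _ = (q - p) * S + (B + 1) * ∫ t in p..q, R' t := by
          rw [intervalIntegral.integral_add, intervalIntegral.integral_const,
            intervalIntegral.integral_const_mul, smul_eq_mul]
          · simp
          · apply ContinuousOn.intervalIntegrable; rw [Set.uIcc_of_le hpq]; fun_prop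
      _ ≤ Real.pi * S + (B + 1) * S := by
          gcongr
          linarith
      _ = _ := by ring
  have hp' := hbd p (Set.left_mem_Icc.mpr hpq)
  have hq' := hbd q (Set.right_mem_Icc.mpr hpq)
  have htot : ‖μ‖ * ‖∫ t in p..q, (Real.sin t : ℂ) * E t‖ ≤ (2 * (B + 1) + Real.pi) * S := by
    rw [← norm_mul, ibp]
    refine (norm_sub_le _ _).trans ?_
    have := norm_sub_le ((V q : ℂ) * E q) ((V p : ℂ) * E p)
    have : (B + 1) * S = (B + 1) * |R p| + (B + 1) * |R q| := by rw [hS]; ring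
    linarith
  rw [div_mul_eq_mul_div, le_div_iff₀ hμ0]
  linarith

/-- Stationary-phase bound: the contribution of the stationary point `cos t = x₀`, with
`δ` the width of the stationary zone measured in `cos t`. -/
theorem norm_integral_sin_mul_le_of_stationary {B x₀ s δ G : ℝ} (hB : 1 < B) (hx₀ : |x₀| < 1)
    (hs : 0 < s) (hs2 : s ^ 2 = 1 - x₀ ^ 2) (hδ : 0 < δ) (hδG : δ ≤ G * s ^ 2) {μ : ℂ}
    (hμ : μ ≠ 0) (hμδ : ‖μ‖ * δ ^ 2 = s) {E : ℝ → ℂ} (hE : ∀ t, ‖E t‖ ≤ 1)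
    (hE' : ∀ t, HasDerivAt E
      (μ * ((Real.cos t - x₀) / (B - Real.cos t) : ℝ) * E t) t) :
    ‖∫ t in (0 : ℝ)..Real.pi, (Real.sin t : ℂ) * E t‖ ≤
      (2 + 2 * (2 * (B + 1) + Real.pi) * √(1 + 2 * G)) * δ := by
  obtain ⟨hx1, hx2⟩ := abs_lt.mp hx₀
  have hEc : Continuous E := continuous_iff_continuousAt.mpr fun t => (hE' t).continuousAt
  have hII : ∀ a b, IntervalIntegrable (fun t => (Real.sin t : ℂ) * E t) MeasureTheory.volume a b :=
    fun a b => Continuous.intervalIntegrable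
      ((Complex.continuous_ofReal.comp Real.continuous_sin).mul hEc) a b
  set y := min 1 (x₀ + δ) with hy
  set z := max (-1) (x₀ - δ) with hz
  have hy1 : y ≤ 1 := min_le_left _ _
  have hyx : x₀ < y := lt_min hx2 (by linarith)
  have hyδ : y ≤ x₀ + δ := min_le_right _ _
  have hz1 : -1 ≤ z := le_max_left _ _
  have hzx : z < x₀ := max_lt hx1 (by linarith)
  have hzδ : x₀ - δ ≤ z := le_max_right _ _
  have hcy : Real.cos (Real.arccos y) = y := Real.cos_arccos (by linarith) hy1
  have hcz : Real.cos (Real.arccos z) = z := Real.cos_arccos hz1 (by linarith)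
  set D := √(1 + 2 * G) * s / δ with hD
  have hsq : √(s ^ 2 + 2 * δ) / δ ≤ D := by
    rw [hD]
    gcongr
    apply Real.sqrt_le_iff.mpr
    refine ⟨by positivity, ?_⟩
    have hG : 0 ≤ G := by
      by_contra! h
      nlinarith [sq_nonneg s]
    rw [mul_pow, Real.sq_sqrt (by positivity)]
    nlinarith
  have hyD : |Real.sin (Real.arccos y) / (Real.cos (Real.arccos y) - x₀)| ≤ D := by
    rw [hcy, Real.sin_arccos]
    rcases le_total 1 (x₀ + δ) with h | h
    · rw [hy, min_eq_left h]
      norm_num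
      positivity
    · refine le_trans ?_ hsq
      rw [hy, min_eq_right h, add_sub_cancel_left, abs_of_nonneg (by positivity)]
      gcongr
      nlinarith
  have hzD : |Real.sin (Real.arccos z) / (Real.cos (Real.arccos z) - x₀)| ≤ D := by
    rw [hcz, Real.sin_arccos]
    rcases le_total (x₀ - δ) (-1) with h | h
    · rw [hz, max_eq_left h]
      norm_num
      positivity
    · refine le_trans ?_ hsq
      rw [hz, max_eq_right h, sub_sub_cancel_left, abs_div, abs_neg, abs_of_pos hδ,
        abs_of_nonneg (Real.sqrt_nonneg _)]
      gcongr
      nlinarith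
  have hμ0 : 0 < ‖μ‖ := norm_pos_iff.mpr hμ
  have hDδ : D / ‖μ‖ = √(1 + 2 * G) * δ := by
    rw [hD, ← hμδ]
    field_simp
  have hord : Real.arccos y ≤ Real.arccos z := Real.antitone_arccos (by linarith)
  have h1 := norm_integral_sin_mul_le_of_cos_ne hB hx₀ hμ hE hE' le_rfl (Real.arccos_nonneg y)
    (Real.arccos_le_pi y) (fun t ht => by
      have := Real.cos_le_cos_of_nonneg_of_le_pi ht.1 (Real.arccos_le_pi y) ht.2
      rw [hcy] at this
      linarith)
  have h3 := norm_integral_sin_mul_le_of_cos_ne hB hx₀ hμ hE hE' (Real.arccos_nonneg z)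
    (Real.arccos_le_pi z) le_rfl (fun t ht => by
      have := Real.cos_le_cos_of_nonneg_of_le_pi (Real.arccos_nonneg z) ht.2 ht.1
      rw [hcz] at this
      linarith)
  have h2 : ‖∫ t in (Real.arccos y)..(Real.arccos z), (Real.sin t : ℂ) * E t‖ ≤ 2 * δ := by
    calc _ ≤ ∫ t in (Real.arccos y)..(Real.arccos z), Real.sin t := by
          apply intervalIntegral.norm_integral_le_of_norm_le hord
          · refine Filter.Eventually.of_forall fun t ht => ?_
            have hst : 0 ≤ Real.sin t := Real.sin_nonneg_of_nonneg_of_le_pi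
              ((Real.arccos_nonneg y).trans ht.1.le) (ht.2.trans (Real.arccos_le_pi z))
            rw [norm_mul, Complex.norm_real, Real.norm_eq_abs, abs_of_nonneg hst]
            exact mul_le_of_le_one_right hst (hE t)
          · exact Real.continuous_sin.intervalIntegrable _ _
      _ = y - z := by rw [integral_sin, hcy, hcz]
      _ ≤ 2 * δ := by linarith
  simp only [Real.sin_zero, Real.sin_pi, zero_div, abs_zero, zero_add, add_zero] at h1 h3
  have hC : 0 ≤ (2 * (B + 1) + Real.pi) := by positivity
  have hCD : (2 * (B + 1) + Real.pi) / ‖μ‖ * D =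
      (2 * (B + 1) + Real.pi) * √(1 + 2 * G) * δ := by
    rw [div_mul_eq_mul_div, mul_div_assoc, hDδ, mul_assoc]
  have h1' := h1.trans (mul_le_mul_of_nonneg_left hyD (by positivity))
  have h3' := h3.trans (mul_le_mul_of_nonneg_left hzD (by positivity))
  rw [hCD] at h1' h3'
  rw [← intervalIntegral.integral_add_adjacent_intervals (hII 0 (Real.arccos z)) (hII _ _),
    ← intervalIntegral.integral_add_adjacent_intervals (hII 0 (Real.arccos y)) (hII _ _)]
  refine (norm_add₃_le).trans ?_
  linarith

theorem coeff_eq_integral_of_hasSum {f : ℂ → ℂ} (hf : DifferentiableOn ℂ f (Metric.closedBall 0 1))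
    {c : ℕ → ℂ} (hc : ∀ z : ℂ, ‖z‖ < 1 → HasSum (fun k => c k * z ^ k) (f z)) (k : ℕ) :
    c k = (2 * Real.pi : ℂ)⁻¹ *
      ∫ t in -Real.pi..Real.pi, (circleMap 0 1 t)⁻¹ ^ k * f (circleMap 0 1 t) := by
  have h1 : HasFPowerSeriesAt f (FormalMultilinearSeries.ofScalars ℂ c) 0 := by
    rw [hasFPowerSeriesAt_iff]
    filter_upwards [Metric.ball_mem_nhds (0 : ℂ) one_pos] with z hz
    simpa [mul_comm] using hc z (by simpa using hz)
  have h2 : HasFPowerSeriesAt f (cauchyPowerSeries f 0 1) 0 :=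
    (DifferentiableOn.hasFPowerSeriesOnBall (R := 1) (by simpa using hf) one_pos).hasFPowerSeriesAt
  have h3 : c k = cauchyPowerSeries f 0 1 k fun _ => 1 := by
    rw [← h1.eq_formalMultilinearSeries h2]
    simp
  have hper : Function.Periodic
      (fun t => (circleMap 0 1 t)⁻¹ ^ k * f (circleMap 0 1 t)) (2 * Real.pi) := fun t => by
    simp only [periodic_circleMap 0 1 t]
  have h4 := hper.intervalIntegral_add_eq (-Real.pi) 0
  rw [show -Real.pi + 2 * Real.pi = Real.pi by ring, zero_add] at h4
  rw [h3, cauchyPowerSeries_apply, circleIntegral, h4, ← intervalIntegral.integral_const_mul,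
    ← intervalIntegral.integral_smul]
  refine intervalIntegral.integral_congr fun t _ => ?_
  have := circleMap_ne_center (c := 0) (R := 1) (θ := t) one_ne_zero
  simp only [deriv_circleMap, sub_zero, smul_eq_mul, one_div]
  field_simp

/-- The Blaschke factor with zero `lam`, along the unit circle. -/
noncomputable def blaschkeCircle (lam t : ℝ) : ℂ :=
  (circleMap 0 1 t - lam) / (1 - lam * circleMap 0 1 t)

theorem one_sub_mul_ne_zero {lam : ℝ} (hlam : lam ∈ Set.Ioo (0 : ℝ) 1) {z : ℂ} (hz : ‖z‖ ≤ 1) :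
    1 - (lam : ℂ) * z ≠ 0 := by
  intro h
  have h1 : ‖(lam : ℂ) * z‖ = 1 := by rw [← sub_eq_zero.mp h, norm_one]
  rw [norm_mul, Complex.norm_real, Real.norm_eq_abs, abs_of_pos hlam.1] at h1
  nlinarith [hlam.1, hlam.2, norm_nonneg z]

theorem circleMap_add_inv (t : ℝ) :
    circleMap 0 1 t + (circleMap 0 1 t)⁻¹ = 2 * (Real.cos t : ℂ) := by
  simp only [circleMap, zero_add, Complex.ofReal_one, one_mul, ← Complex.exp_neg,
    Complex.ofReal_cos, Complex.two_cos, neg_mul]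

theorem circleMap_sub_inv (t : ℝ) :
    circleMap 0 1 t - (circleMap 0 1 t)⁻¹ = 2 * Complex.I * (Real.sin t : ℂ) := by
  simp only [circleMap, zero_add, Complex.ofReal_one, one_mul, ← Complex.exp_neg,
    Complex.ofReal_sin]
  have := Complex.two_sin (t : ℂ)
  rw [neg_mul] at this
  linear_combination (-Complex.I) * this +
    (Complex.exp (t * Complex.I) - Complex.exp (-(t * Complex.I))) * Complex.I_sq

theorem blaschke_denom_eq (lam t : ℝ) :
    (circleMap 0 1 t - lam) * (1 - lam * circleMap 0 1 t) =
      circleMap 0 1 t * ((1 + lam ^ 2 - 2 * lam * Real.cos t : ℝ) : ℂ) := by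
  have h := circleMap_add_inv t
  have h0 : circleMap 0 1 t ≠ 0 := circleMap_ne_center one_ne_zero
  push_cast at h ⊢
  have h' : circleMap 0 1 t ^ 2 + 1 = 2 * Complex.cos t * circleMap 0 1 t := by
    rw [← h]; field_simp
  linear_combination (-lam : ℂ) * h'

theorem norm_blaschkeCircle_le (lam t : ℝ) : ‖blaschkeCircle lam t‖ ≤ 1 := by
  have h : ‖circleMap 0 1 t - lam‖ = ‖1 - lam * circleMap 0 1 t‖ := by
    rw [← sq_eq_sq₀ (norm_nonneg _) (norm_nonneg _), ← Complex.normSq_eq_norm_sq,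
      ← Complex.normSq_eq_norm_sq, Complex.normSq_apply, Complex.normSq_apply]
    simp [circleMap, Complex.exp_ofReal_mul_I_re, Complex.exp_ofReal_mul_I_im]
    linear_combination (1 - lam ^ 2) * Real.sin_sq_add_cos_sq t
  rw [blaschkeCircle, norm_div, h]
  exact div_self_le_one _

theorem hasDerivAt_blaschkeCircle {lam : ℝ} (hlam : lam ∈ Set.Ioo (0 : ℝ) 1) (t : ℝ) :
    HasDerivAt (blaschkeCircle lam) (Complex.I *
      ((1 - lam ^ 2) / (1 + lam ^ 2 - 2 * lam * Real.cos t) : ℝ) * blaschkeCircle lam t) t := by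
  have hd : 1 - (lam : ℂ) * circleMap 0 1 t ≠ 0 := one_sub_mul_ne_zero hlam (by simp)
  have h0 : circleMap 0 1 t ≠ 0 := circleMap_ne_center one_ne_zero
  have hq : (0 : ℝ) < 1 + lam ^ 2 - 2 * lam * Real.cos t := by
    nlinarith [hlam.1, hlam.2, Real.cos_le_one t, mul_nonneg hlam.1.le (sub_nonneg.mpr (Real.cos_le_one t))]
  have hc := hasDerivAt_circleMap 0 1 t
  refine ((hc.sub_const (lam : ℂ)).fun_div ((hc.const_mul (lam : ℂ)).const_sub 1) hd).congr_deriv ?_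
  have hq' : ((1 + lam ^ 2 - 2 * lam * Real.cos t : ℝ) : ℂ) ≠ 0 := by exact_mod_cast hq.ne'
  have hb := blaschke_denom_eq lam t
  rw [blaschkeCircle, Complex.ofReal_div]
  generalize ((1 + lam ^ 2 - 2 * lam * Real.cos t : ℝ) : ℂ) = q at hq' hb ⊢
  rw [div_eq_iff (pow_ne_zero 2 hd)]
  field_simp
  push_cast
  linear_combination (-(1 - lam ^ 2 : ℂ)) * hb

/-- The unimodular oscillating factor of the coefficient integral. -/
noncomputable def oscFactor (lam : ℝ) (n : ℕ) (κ t : ℝ) : ℂ :=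
  blaschkeCircle lam t ^ n * Complex.exp (-(κ * t : ℝ) * Complex.I)

theorem norm_oscFactor_le (lam : ℝ) (n : ℕ) (κ t : ℝ) : ‖oscFactor lam n κ t‖ ≤ 1 := by
  rw [oscFactor, norm_mul, ← Complex.ofReal_neg, Complex.norm_exp_ofReal_mul_I, mul_one, norm_pow]
  exact pow_le_one₀ (norm_nonneg _) (norm_blaschkeCircle_le lam t)

theorem hasDerivAt_oscFactor {lam : ℝ} (hlam : lam ∈ Set.Ioo (0 : ℝ) 1) (n : ℕ) (κ t : ℝ) :
    HasDerivAt (oscFactor lam n κ) (Complex.I *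
      (n * ((1 - lam ^ 2) / (1 + lam ^ 2 - 2 * lam * Real.cos t)) - κ : ℝ) *
      oscFactor lam n κ t) t := by
  have he : HasDerivAt (fun t : ℝ => Complex.exp (-(κ * t : ℝ) * Complex.I))
      (Complex.exp (-(κ * t : ℝ) * Complex.I) * (-(κ * 1 : ℝ) * Complex.I)) t :=
    ((((hasDerivAt_id t).const_mul κ).ofReal_comp.neg).mul_const Complex.I).cexp
  refine (((hasDerivAt_blaschkeCircle hlam t).fun_pow n).fun_mul he).congr_deriv ?_
  rw [oscFactor]
  rcases Nat.eq_zero_or_pos n with rfl | hn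
  · simp; ring
  · have := pow_sub_one_mul hn.ne' (blaschkeCircle lam t)
    push_cast
    rw [← this]
    ring

theorem hasDerivAt_oscFactor_of_pos {lam : ℝ} (hlam : lam ∈ Set.Ioo (0 : ℝ) 1) (n : ℕ) {κ : ℝ}
    (hκ : 0 < κ) (t : ℝ) :
    HasDerivAt (oscFactor lam n κ) (Complex.I * κ *
      ((Real.cos t - ((1 + lam ^ 2) / (2 * lam) - n * ((1 - lam ^ 2) / (2 * lam)) / κ)) /
        ((1 + lam ^ 2) / (2 * lam) - Real.cos t) : ℝ) * oscFactor lam n κ t) t := by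
  refine (hasDerivAt_oscFactor hlam n κ t).congr_deriv ?_
  rw [mul_assoc Complex.I (κ : ℂ), ← Complex.ofReal_mul]
  congr 3
  have hq : (0 : ℝ) < 1 + lam ^ 2 - 2 * lam * Real.cos t := by
    nlinarith [hlam.1, hlam.2, Real.cos_le_one t, mul_nonneg hlam.1.le (sub_nonneg.mpr (Real.cos_le_one t))]
  have hl := hlam.1
  have : (1 + lam ^ 2) / (2 * lam) - Real.cos t = (1 + lam ^ 2 - 2 * lam * Real.cos t) / (2 * lam) := by
    field_simp
  rw [this]
  have := hq.ne'
  generalize hqd : 1 + lam ^ 2 - 2 * lam * Real.cos t = q at this ⊢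
  field_simp
  linear_combination κ * hqd

theorem norm_coeff_le {lam : ℝ} (hlam : lam ∈ Set.Ioo (0 : ℝ) 1) {n : ℕ} {c : ℕ → ℂ}
    (hc : ∀ z : ℂ, ‖z‖ < 1 → HasSum (fun k => c k * z ^ k)
      ((1 - z ^ 2) * ((z - (lam : ℂ)) / (1 - (lam : ℂ) * z)) ^ n)) (k : ℕ) {C : ℝ}
    (h₁ : ‖∫ t in (0 : ℝ)..Real.pi, (Real.sin t : ℂ) * oscFactor lam n (k - 1) t‖ ≤ C)
    (h₂ : ‖∫ t in (0 : ℝ)..Real.pi, (Real.sin t : ℂ) * oscFactor lam n (k - 1) (-t)‖ ≤ C) :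
    ‖c k‖ ≤ C := by
  have hf : DifferentiableOn ℂ
      (fun z => (1 - z ^ 2) * ((z - (lam : ℂ)) / (1 - (lam : ℂ) * z)) ^ n)
      (Metric.closedBall 0 1) := by
    refine DifferentiableOn.mul (by fun_prop) (DifferentiableOn.pow (DifferentiableOn.div
      (by fun_prop) (by fun_prop) fun z hz => one_sub_mul_ne_zero hlam (by simpa using hz)) n)
  have hint : ∀ t : ℝ, (circleMap 0 1 t)⁻¹ ^ k * ((1 - circleMap 0 1 t ^ 2) *
      ((circleMap 0 1 t - (lam : ℂ)) / (1 - (lam : ℂ) * circleMap 0 1 t)) ^ n) =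
      (-2 * Complex.I) * ((Real.sin t : ℂ) * oscFactor lam n (k - 1) t) := fun t => by
    have h0 : circleMap 0 1 t ≠ 0 := circleMap_ne_center one_ne_zero
    have he : Complex.exp (-((k - 1 : ℝ) * t : ℝ) * Complex.I) =
        (circleMap 0 1 t)⁻¹ ^ k * circleMap 0 1 t := by
      simp only [circleMap, zero_add, Complex.ofReal_one, one_mul, ← Complex.exp_neg,
        ← Complex.exp_nat_mul, ← Complex.exp_add]
      congr 1
      push_cast
      ring
    have hs := circleMap_sub_inv t
    have hs' : 1 - circleMap 0 1 t ^ 2 =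
        -2 * Complex.I * (Real.sin t : ℂ) * circleMap 0 1 t := by
      rw [show -2 * Complex.I * (Real.sin t : ℂ) = -(2 * Complex.I * (Real.sin t : ℂ)) by ring,
        ← hs]
      field_simp
      ring
    rw [oscFactor, blaschkeCircle, he, hs']
    ring
  rw [coeff_eq_integral_of_hasSum hf hc k]
  simp only [hint]
  have hcont : Continuous fun t : ℝ => (Real.sin t : ℂ) * oscFactor lam n (k - 1) t :=
    (Complex.continuous_ofReal.comp Real.continuous_sin).mul
      (continuous_iff_continuousAt.mpr fun t => (hasDerivAt_oscFactor hlam n _ t).continuousAt)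
  have hneg : ∫ t in -Real.pi..0, (Real.sin t : ℂ) * oscFactor lam n (k - 1) t =
      -∫ t in (0 : ℝ)..Real.pi, (Real.sin t : ℂ) * oscFactor lam n (k - 1) (-t) := by
    have := intervalIntegral.integral_comp_neg (a := 0) (b := Real.pi)
      fun t => (Real.sin t : ℂ) * oscFactor lam n (k - 1) t
    rw [neg_zero] at this
    rw [← this, ← intervalIntegral.integral_neg]
    simp
  rw [intervalIntegral.integral_const_mul, ← intervalIntegral.integral_add_adjacent_intervals
    (hcont.intervalIntegrable (-Real.pi) 0) (hcont.intervalIntegrable 0 Real.pi), hneg]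
  have hsum := norm_add_le (-∫ t in (0 : ℝ)..Real.pi, (Real.sin t : ℂ) *
    oscFactor lam n (k - 1) (-t)) (∫ t in (0 : ℝ)..Real.pi, (Real.sin t : ℂ) *
    oscFactor lam n (k - 1) t)
  rw [norm_neg] at hsum
  have hC : 0 ≤ C := (norm_nonneg _).trans h₁
  have hpi := Real.pi_gt_three
  simp only [norm_mul, norm_inv, norm_neg, Complex.norm_I, Complex.norm_real, Complex.norm_ofNat,
    Real.norm_eq_abs, abs_of_pos Real.pi_pos]
  rw [inv_mul_le_iff₀ (by positivity)]
  nlinarith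

theorem norm_integral_oscFactor_le {lam : ℝ} (hlam : lam ∈ Set.Ioo (0 : ℝ) 1) {n : ℕ}
    {κ s δ G x₀ : ℝ} (hκ : 0 < κ)
    (hx : x₀ = (1 + lam ^ 2) / (2 * lam) - n * ((1 - lam ^ 2) / (2 * lam)) / κ)
    (hx₀ : |x₀| < 1) (hs : 0 < s) (hs2 : s ^ 2 = 1 - x₀ ^ 2) (hδ : 0 < δ) (hδG : δ ≤ G * s ^ 2)
    (hκδ : κ * δ ^ 2 = s) :
    ‖∫ t in (0 : ℝ)..Real.pi, (Real.sin t : ℂ) * oscFactor lam n κ t‖ ≤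
      (2 + 2 * (2 * ((1 + lam ^ 2) / (2 * lam) + 1) + Real.pi) * √(1 + 2 * G)) * δ ∧
    ‖∫ t in (0 : ℝ)..Real.pi, (Real.sin t : ℂ) * oscFactor lam n κ (-t)‖ ≤
      (2 + 2 * (2 * ((1 + lam ^ 2) / (2 * lam) + 1) + Real.pi) * √(1 + 2 * G)) * δ := by
  have hl := hlam.1
  have hB : 1 < (1 + lam ^ 2) / (2 * lam) := by
    rw [one_lt_div (by positivity)]
    nlinarith [sq_pos_of_pos (sub_pos.mpr hlam.2)]
  have hκ' : (κ : ℂ) ≠ 0 := by exact_mod_cast hκ.ne'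
  have hn : ‖Complex.I * κ‖ = κ := by simp [hκ.le]
  have hd := hasDerivAt_oscFactor_of_pos hlam n hκ
  rw [← hx] at hd
  constructor
  · exact norm_integral_sin_mul_le_of_stationary hB hx₀ hs hs2 hδ hδG
      (mul_ne_zero Complex.I_ne_zero hκ') (by rw [hn, hκδ]) (norm_oscFactor_le lam n κ) hd
  · refine norm_integral_sin_mul_le_of_stationary (μ := -(Complex.I * κ)) hB hx₀ hs hs2 hδ hδG
      (neg_ne_zero.mpr (mul_ne_zero Complex.I_ne_zero hκ')) (by rw [norm_neg, hn, hκδ])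
      (fun t => norm_oscFactor_le lam n κ (-t)) fun t => ?_
    have h := (hd (-t)).scomp t (hasDerivAt_neg t)
    refine h.congr_deriv ?_
    simp only [Real.cos_neg, neg_smul, one_smul]
    ring

/-- The stationary point `x₀` in terms of the distances `u`, `v` of `k / n` to the two edges, with
`a` the shifted frequency `(k - 1) / n`. -/
theorem stationary_bounds {A α a u v h m : ℝ} (hA : 0 < A) (hα : 0 < α)
    (hm : 0 < m) (hu : h ≤ u) (hv : h ≤ v) (hmh : 2 * m ≤ h) (huv : u + v = α⁻¹ - α)
    (ha : a = α + u - m) {x₀ : ℝ} (hx : 1 + x₀ = A * (α⁻¹ - a⁻¹)) (hx' : 1 - x₀ = A * (a⁻¹ - α)) :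
    α ≤ a ∧ |x₀| < 1 ∧ 1 - x₀ ^ 2 ≤ 2 * A ^ 2 / α ^ 2 * (u * v) ∧
      A ^ 2 * α ^ 2 * (α⁻¹ - α) / 4 * h ≤ 1 - x₀ ^ 2 := by
  have hαi : α * α⁻¹ = 1 := mul_inv_cancel₀ hα.ne'
  have hαa : α < a := by linarith
  have ha0 : 0 < a := hα.trans hαa
  have haα : a < α⁻¹ := by linarith
  have h1 : 1 + x₀ = A / (α * a) * (u - m) := by
    rw [hx, show u - m = a - α by linarith]; field_simp
  have h2 : 1 - x₀ = A * α / a * (v + m) := by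
    rw [hx', show v + m = α⁻¹ - a by linarith]; field_simp
  have h3 : 1 - x₀ ^ 2 = A ^ 2 / a ^ 2 * ((u - m) * (v + m)) := by
    rw [show 1 - x₀ ^ 2 = (1 + x₀) * (1 - x₀) by ring, h1, h2]; field_simp
  have hum : 0 < u - m := by linarith
  have hvm : 0 < v + m := by linarith
  refine ⟨hαa.le, ?_, ?_, ?_⟩
  · have : 0 < 1 + x₀ := by rw [h1]; positivity
    have : 0 < 1 - x₀ := by rw [h2]; positivity
    rw [abs_lt]; constructor <;> linarith
  · rw [h3, show 2 * A ^ 2 / α ^ 2 * (u * v) = A ^ 2 / α ^ 2 * (u * (2 * v)) by ring]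
    gcongr <;> linarith
  · have huv' : (α⁻¹ - α) / 2 * h ≤ u * v := by
      rw [← huv]
      nlinarith
    have : u / 2 * v ≤ (u - m) * (v + m) := by
      apply mul_le_mul <;> linarith
    rw [h3]
    have haa : α ^ 2 ≤ (a ^ 2)⁻¹ := by
      rw [← inv_pow]
      gcongr
      rw [le_inv_comm₀ hα ha0]
      exact haα.le
    calc A ^ 2 * α ^ 2 * (α⁻¹ - α) / 4 * h = A ^ 2 * α ^ 2 * ((α⁻¹ - α) / 2 * h / 2) := by ring
      _ ≤ A ^ 2 * (a ^ 2)⁻¹ * ((u - m) * (v + m)) := by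
        have : 0 ≤ (α⁻¹ - α) / 2 * h := mul_nonneg (by linarith) (by linarith)
        gcongr
        linarith
      _ = _ := by rw [div_eq_mul_inv]

theorem exists_forall_norm_coeff_le {lam : ℝ} (hlam : lam ∈ Set.Ioo (0 : ℝ) 1) {α : ℝ}
    (hα : α = (1 - lam) / (1 + lam)) :
    ∃ M : ℝ, 0 < M ∧ ∀ n : ℕ, 0 < n → ∀ c : ℕ → ℂ,
      (∀ z : ℂ, ‖z‖ < 1 → HasSum (fun k => c k * z ^ k)
        ((1 - z ^ 2) * ((z - (lam : ℂ)) / (1 - (lam : ℂ) * z)) ^ n)) →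
      ∀ (k : ℕ) (h : ℝ), 0 < h → h ^ 3 = ((n : ℝ) ^ 2)⁻¹ → 2 * (n : ℝ)⁻¹ ≤ h →
      h ≤ k / n - α → h ≤ α⁻¹ - k / n → ∀ P : ℝ, 0 ≤ P →
      P ^ 4 = ((n : ℝ) ^ 2)⁻¹ * ((k / n - α) * (α⁻¹ - k / n)) → ‖c k‖ ≤ M * P := by
  obtain ⟨hl0, hl1⟩ := hlam
  have hα0 : 0 < α := by rw [hα]; exact div_pos (by linarith) (by linarith)
  have hα1 : α < 1 := by rw [hα, div_lt_one (by linarith)]; linarith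
  set A := (1 - lam ^ 2) / (2 * lam) with hA
  set B := (1 + lam ^ 2) / (2 * lam) with hB
  have hA0 : 0 < A := div_pos (by nlinarith) (by linarith)
  have hB0 : 0 < B := by positivity
  have hl1' : 1 - lam ≠ 0 := by linarith
  have hBA : B + 1 = A * α⁻¹ := by rw [hB, hA, hα]; field_simp; ring
  have hBA' : B - 1 = A * α := by rw [hB, hA, hα]; field_simp; ring
  set c₁ := A ^ 2 * α ^ 2 * (α⁻¹ - α) / 4 with hc₁
  have hαα : 0 < α⁻¹ - α := by
    have := (one_lt_inv₀ hα0).mpr hα1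
    linarith
  have hc₁0 : 0 < c₁ := by positivity
  set c₀ := α ^ 2 * c₁ ^ 3 with hc₀
  have hc₀0 : 0 < c₀ := by positivity
  set G := 1 + c₀⁻¹ with hG
  set W := 1 + 2 * A ^ 2 / α ^ 4 with hW
  set C := 2 + 2 * (2 * (B + 1) + Real.pi) * √(1 + 2 * G) with hC
  have hC0 : 0 < C := by positivity
  refine ⟨C * W, by positivity, fun n hn c hc k h hh hh3 hnh hu hv P hP hP4 => ?_⟩
  have hn0 : (0 : ℝ) < n := by exact_mod_cast hn
  set κ : ℝ := k - 1 with hκ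
  set x₀ := B - n * A / κ with hx₀
  set a := κ / n with ha
  have hna : n * A / κ = A * a⁻¹ := by rw [ha, inv_div]; ring
  obtain ⟨hαa, hx1, hup, hlow⟩ := stationary_bounds (a := a) (x₀ := x₀) hA0 hα0
    (inv_pos.mpr hn0) hu hv hnh (by ring) (by rw [ha, hκ]; field_simp; ring)
    (by rw [hx₀, hna]; linear_combination hBA) (by rw [hx₀, hna]; linear_combination -hBA')
  have hκα : α * n ≤ κ := (le_div_iff₀ hn0).mp hαa
  have hκ0 : 0 < κ := lt_of_lt_of_le (by positivity) hκα
  have hs0 : 0 < 1 - x₀ ^ 2 := lt_of_lt_of_le (by positivity) hlow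
  set s := √(1 - x₀ ^ 2) with hs
  have hsp : 0 < s := Real.sqrt_pos.mpr hs0
  have hs2 : s ^ 2 = 1 - x₀ ^ 2 := Real.sq_sqrt hs0.le
  set δ := √(s / κ) with hδ
  have hδp : 0 < δ := Real.sqrt_pos.mpr (by positivity)
  have hδ2 : δ ^ 2 = s / κ := Real.sq_sqrt (by positivity)
  have hδ4 : δ ^ 4 = s ^ 2 / κ ^ 2 := by
    rw [show δ ^ 4 = (δ ^ 2) ^ 2 by ring, hδ2, div_pow]
  have hδG : δ ≤ G * s ^ 2 := by
    apply le_of_pow_le_pow_left₀ four_ne_zero (by positivity)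
    rw [hδ4, div_le_iff₀ (by positivity)]
    have h6 : c₀ ≤ κ ^ 2 * (s ^ 2) ^ 3 := by
      calc c₀ = (α * n) ^ 2 * (c₁ * h) ^ 3 := by
            rw [mul_pow c₁, hh3, hc₀]; field_simp
        _ ≤ κ ^ 2 * (s ^ 2) ^ 3 := by
            rw [hs2]; gcongr
    have hG1 : 1 ≤ G := by
      rw [hG]; linarith [inv_pos.mpr hc₀0]
    have hGc : 1 ≤ G ^ 4 * c₀ := by
      have h1 : G ≤ G ^ 4 := le_self_pow₀ hG1 four_ne_zero
      have h2 : 1 ≤ G * c₀ := by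
        rw [hG, add_mul, inv_mul_cancel₀ hc₀0.ne']; linarith
      exact h2.trans (by gcongr)
    calc s ^ 2 = s ^ 2 * 1 := by ring
      _ ≤ s ^ 2 * (G ^ 4 * (κ ^ 2 * (s ^ 2) ^ 3)) := by
        gcongr
        exact hGc.trans (by gcongr)
      _ = (G * s ^ 2) ^ 4 * κ ^ 2 := by ring
  have hosc := norm_integral_oscFactor_le ⟨hl0, hl1⟩ (n := n) hκ0 rfl hx1 hsp hs2 hδp hδG
    (by rw [hδ2]; field_simp)
  have hck : ‖c k‖ ≤ C * δ := norm_coeff_le ⟨hl0, hl1⟩ hc k hosc.1 hosc.2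
  refine hck.trans ?_
  rw [mul_assoc C]
  gcongr
  have hu0 : 0 < k / n - α := hh.trans_le hu
  have hv0 : 0 < α⁻¹ - k / n := hh.trans_le hv
  apply le_of_pow_le_pow_left₀ four_ne_zero (by positivity)
  have hW1 : 1 ≤ W := by
    rw [hW]; linarith [show 0 < 2 * A ^ 2 / α ^ 4 by positivity]
  have hW4 : 2 * A ^ 2 / α ^ 4 ≤ W ^ 4 := by
    have h1 : W ≤ W ^ 4 := le_self_pow₀ hW1 four_ne_zero
    linarith
  calc δ ^ 4 = (1 - x₀ ^ 2) / κ ^ 2 := by rw [hδ4, hs2]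
    _ ≤ (2 * A ^ 2 / α ^ 2 * ((k / n - α) * (α⁻¹ - k / n))) / (α * n) ^ 2 := by gcongr
    _ = 2 * A ^ 2 / α ^ 4 * (((n : ℝ) ^ 2)⁻¹ * ((k / n - α) * (α⁻¹ - k / n))) := by
      field_simp
    _ ≤ W ^ 4 * P ^ 4 := by
      rw [hP4]; gcongr
    _ = (W * P) ^ 4 := by ring


/-- In the oscillatory region k/n ∈ (α₀ + n^{−2/3}, β] ∪ [β^{−1}, α₀^{−1} − n^{−2/3})
the Taylor coefficients c_{n,k} of F_n(z) = (1−z²)·((z−λ)/(1−λz))ⁿ satisfy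
|c_{n,k}| ≤ M·n^{−1/2}·(k/n − α₀)^{1/4}·(α₀^{−1} − k/n)^{1/4}. -/
theorem coeff_bound_oscillatory_edge_regions
    (lam : ℝ) (hlam : lam ∈ Set.Ioo (0 : ℝ) 1)
    (alpha0 : ℝ) (halpha0 : alpha0 = (1 - lam) / (1 + lam))
    (beta : ℝ) (hbeta : beta ∈ Set.Ioo alpha0 1)
    (c : ℕ → ℕ → ℂ)
    (hc : ∀ n : ℕ, 1 ≤ n → ∀ z : ℂ, ‖z‖ < 1 →
      Summable (fun k : ℕ => c n k * z ^ k) ∧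
      ∑' k : ℕ, c n k * z ^ k =
        (1 - z ^ 2) * ((z - (lam : ℂ)) / (1 - (lam : ℂ) * z)) ^ n) :
    ∃ M : ℝ, 0 < M ∧ ∃ N : ℕ, ∀ n : ℕ, N ≤ n → ∀ k : ℕ,
      ((alpha0 + (n : ℝ) ^ (-(2 : ℝ) / 3) < (k : ℝ) / n ∧ (k : ℝ) / n ≤ beta) ∨
        (beta⁻¹ ≤ (k : ℝ) / n ∧ (k : ℝ) / n < alpha0⁻¹ - (n : ℝ) ^ (-(2 : ℝ) / 3))) →
      ‖c n k‖ ≤ M * (n : ℝ) ^ (-(1 : ℝ) / 2) * ((k : ℝ) / n - alpha0) ^ ((1 : ℝ) / 4) *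
        (alpha0⁻¹ - (k : ℝ) / n) ^ ((1 : ℝ) / 4) := by
  have hα0 : 0 < alpha0 := by
    rw [halpha0]; exact div_pos (by linarith [hlam.2]) (by linarith [hlam.1])
  have hα1 : alpha0 < 1 := hbeta.1.trans hbeta.2
  have hβ0 : 0 < beta := hα0.trans hbeta.1
  have hαi : 1 - alpha0 ≤ alpha0⁻¹ - 1 := by
    have := mul_inv_cancel₀ hα0.ne'
    nlinarith [sq_nonneg (alpha0 - 1), (one_lt_inv₀ hα0).mpr hα1]
  obtain ⟨M, hM, H⟩ := exists_forall_norm_coeff_le hlam halpha0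
  have hlim : Filter.Tendsto (fun n : ℕ => (n : ℝ) ^ (-(2 : ℝ) / 3)) Filter.atTop (nhds 0) := by
    have := (tendsto_rpow_neg_atTop (show (0 : ℝ) < 2 / 3 by norm_num)).comp
      tendsto_natCast_atTop_atTop
    simpa [Function.comp_def, neg_div] using this
  obtain ⟨N, hN⟩ := Filter.eventually_atTop.mp
    ((hlim.eventually_lt_const (sub_pos.mpr hα1)).and (Filter.eventually_ge_atTop 8))
  refine ⟨M, hM, N, fun n hn k hk => ?_⟩
  obtain ⟨hsmall, hn8⟩ := hN n hn
  have hn8' : (8 : ℝ) ≤ n := by exact_mod_cast hn8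
  have hn0 : (0 : ℝ) < n := by linarith
  have hβi : 1 ≤ beta⁻¹ := (one_lt_inv₀ hβ0).mpr hbeta.2 |>.le
  have hb := hbeta.2
  set h := (n : ℝ) ^ (-(2 : ℝ) / 3) with hh
  have hh0 : 0 < h := Real.rpow_pos_of_pos hn0 _
  have hh3 : h ^ 3 = ((n : ℝ) ^ 2)⁻¹ := by
    rw [hh, ← Real.rpow_mul_natCast hn0.le, ← Real.rpow_natCast, ← Real.rpow_neg hn0.le]
    norm_num
  have hnh : 2 * (n : ℝ)⁻¹ ≤ h := by
    apply le_of_pow_le_pow_left₀ three_ne_zero hh0.le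
    rw [hh3, mul_pow, inv_pow, ← div_eq_mul_inv, div_le_iff₀ (by positivity)]
    field_simp
    linarith
  have huv : h ≤ k / n - alpha0 ∧ h ≤ alpha0⁻¹ - k / n := by
    rcases hk with ⟨h1, h2⟩ | ⟨h1, h2⟩ <;> constructor <;> linarith
  have hu0 : 0 ≤ (k : ℝ) / n - alpha0 := hh0.le.trans huv.1
  have hv0 : 0 ≤ alpha0⁻¹ - (k : ℝ) / n := hh0.le.trans huv.2
  rw [mul_assoc, mul_assoc]
  refine H n (by omega) (c n) (fun z hz => ?_) k h hh0 hh3 hnh huv.1 huv.2 _ (by positivity) ?_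
  · obtain ⟨h1, h2⟩ := hc n (by omega) z hz
    exact h2 ▸ h1.hasSum
  · rw [mul_pow, mul_pow, ← Real.rpow_mul_natCast hn0.le, ← Real.rpow_mul_natCast hu0,
      ← Real.rpow_mul_natCast hv0, ← Real.rpow_natCast (n : ℝ) 2, ← Real.rpow_neg hn0.le]
    norm_num
end

section
/- Fix λ ∈ (0,1), set α₀ = (1−λ)/(1+λ), and fix β ∈ (α₀, 1). Then there exist a constant M > 0 and an integer N such that for all n ≥ N and every integer k with β < k/n < β^{−1}, one has |c_{n,k}| ≤ √( 2(1−λ²)/(πn) ) · (k/n − α₀)^{1/4} · (α₀^{−1} − k/n)^{1/4} / ( λ · (k/n)^{3/2} ) · ( 1 + M/n ). -/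
open MeasureTheory Filter Topology

/-- First derivative test: an oscillatory integral over `[s, q]` whose phase derivative grows at
least linearly. -/
lemma norm_integral_le_of_linear_phase_deriv {s q m B B₁ B₂ ν : ℝ} {E p p₁ g g₁ : ℝ → ℂ}
    (hν : 0 < ν) (hm : 0 < m) (hs : 0 < s) (hsq : s ≤ q)
    (hE : ∀ x, HasDerivAt E (ν * p x * E x) x)
    (hp : ∀ x, HasDerivAt p (p₁ x) x) (hg : ∀ x, HasDerivAt g (g₁ x) x)
    (hp₁ : Continuous p₁) (hg₁ : Continuous g₁)
    (hEb : ∀ x ∈ Set.Icc s q, ‖E x‖ ≤ 1) (hgb : ∀ x ∈ Set.Icc s q, ‖g x‖ ≤ B)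
    (hg₁b : ∀ x ∈ Set.Icc s q, ‖g₁ x‖ ≤ B₁) (hp₁b : ∀ x ∈ Set.Icc s q, ‖p₁ x‖ ≤ B₂)
    (hpm : ∀ x ∈ Set.Icc s q, m * x ≤ ‖p x‖) :
    ‖∫ x in s..q, g x * E x‖ ≤ (2 * B / m + B₁ * q / m + B * B₂ / m ^ 2) / (ν * s) := by
  have hs_mem : s ∈ Set.Icc s q := ⟨le_rfl, hsq⟩
  have hq_mem : q ∈ Set.Icc s q := ⟨hsq, le_rfl⟩
  have hB : 0 ≤ B := (norm_nonneg _).trans (hgb s hs_mem)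
  have hB₁ : 0 ≤ B₁ := (norm_nonneg _).trans (hg₁b s hs_mem)
  have hB₂ : 0 ≤ B₂ := (norm_nonneg _).trans (hp₁b s hs_mem)
  have hx0 : ∀ x ∈ Set.Icc s q, 0 < x := fun x hx => hs.trans_le hx.1
  have hp0 : ∀ x ∈ Set.Icc s q, p x ≠ 0 := fun x hx h => by
    have := hpm x hx
    rw [h, norm_zero] at this
    exact absurd this (not_le.2 (mul_pos hm (hx0 x hx)))
  have cE : Continuous E := continuous_iff_continuousAt.2 fun x => (hE x).continuousAt
  have cp : Continuous p := continuous_iff_continuousAt.2 fun x => (hp x).continuousAt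
  have cg : Continuous g := continuous_iff_continuousAt.2 fun x => (hg x).continuousAt
  have hu : Set.uIcc s q = Set.Icc s q := Set.uIcc_of_le hsq
  have hν' : (ν : ℂ) ≠ 0 := by exact_mod_cast hν.ne'
  set h' : ℝ → ℂ := fun x => (g₁ x * p x - g x * p₁ x) / p x ^ 2 with hh'
  have ch' : ContinuousOn h' (Set.Icc s q) := by
    refine ContinuousOn.div (by fun_prop) (by fun_prop) fun x hx => pow_ne_zero _ (hp0 x hx)
  have ibp := intervalIntegral.integral_mul_deriv_eq_deriv_mul (a := s) (b := q)
    (u := fun x => g x / p x) (v := E) (u' := h') (v' := fun x => ν * p x * E x)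
    (fun x hx => (hg x).div (hp x) (hp0 x (hu ▸ hx))) (fun x _ => hE x)
    (ContinuousOn.intervalIntegrable (hu ▸ ch'))
    (Continuous.intervalIntegrable (by fun_prop) _ _)
  have e1 : ∫ x in s..q, g x / p x * (ν * p x * E x) = ν * ∫ x in s..q, g x * E x := by
    rw [← intervalIntegral.integral_const_mul]
    refine intervalIntegral.integral_congr fun x hx => ?_
    have := hp0 x (hu ▸ hx)
    field_simp
  rw [e1] at ibp
  have hbd : ∀ x ∈ Set.Icc s q, ‖g x / p x * E x‖ ≤ B / (m * s) := fun x hx => by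
    rw [norm_mul, norm_div]
    calc ‖g x‖ / ‖p x‖ * ‖E x‖ ≤ ‖g x‖ / ‖p x‖ * 1 := by gcongr; exact hEb x hx
      _ ≤ B / (m * s) := by
        rw [mul_one]
        have h1 : m * s ≤ ‖p x‖ := le_trans (by gcongr; exact hx.1) (hpm x hx)
        have h2 : 0 < m * s := mul_pos hm hs
        have h3 := hgb x hx
        gcongr
  set K := B₁ * q / m + B * B₂ / m ^ 2 with hK
  have hq : 0 < q := hs.trans_le hsq
  have hK0 : 0 ≤ K := by positivity
  have hder : ∀ x ∈ Set.Icc s q, ‖h' x * E x‖ ≤ K * x ^ (-2 : ℤ) := fun x hx => by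
    have hx' := hx0 x hx
    have h2 : 0 < m * x := mul_pos hm hx'
    have h1 := hpm x hx
    have h0 : 0 < ‖p x‖ := h2.trans_le h1
    have e : h' x = g₁ x / p x - g x * p₁ x / p x ^ 2 := by
      have := hp0 x hx
      simp only [hh']
      field_simp
    calc ‖h' x * E x‖ ≤ ‖h' x‖ * 1 := by rw [norm_mul]; gcongr; exact hEb x hx
      _ ≤ ‖g₁ x‖ / ‖p x‖ + ‖g x‖ * ‖p₁ x‖ / ‖p x‖ ^ 2 := by
        rw [mul_one, e]
        refine (norm_sub_le _ _).trans (le_of_eq ?_)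
        simp
      _ ≤ B₁ / (m * x) + B * B₂ / (m * x) ^ 2 := by
        have := hgb x hx
        have := hg₁b x hx
        have := hp₁b x hx
        gcongr
      _ ≤ B₁ * q / (m * x ^ 2) + B * B₂ / (m * x) ^ 2 := by
        gcongr ?_ + _
        rw [div_le_div_iff₀ h2 (by positivity)]
        have : x * (B₁ * m * x) ≤ q * (B₁ * m * x) := by gcongr; exact hx.2
        nlinarith
      _ = K * x ^ (-2 : ℤ) := by
        rw [hK, zpow_neg]
        norm_cast
        field_simp
  have hint : ‖∫ x in s..q, h' x * E x‖ ≤ K / s := by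
    have h0 : (0 : ℝ) ∉ Set.uIcc s q := by
      rw [hu]; exact fun h => absurd h.1 (not_le.2 hs)
    refine (intervalIntegral.norm_integral_le_of_norm_le hsq
      (g := fun x => K * x ^ (-2 : ℤ)) (ae_of_all _ fun x hx => hder x ⟨hx.1.le, hx.2⟩)
      ((intervalIntegral.intervalIntegrable_zpow (Or.inr h0)).const_mul K)).trans ?_
    rw [intervalIntegral.integral_const_mul, integral_zpow (Or.inr ⟨by norm_num, h0⟩)]
    have : (q ^ (-2 + 1 : ℤ) - s ^ (-2 + 1 : ℤ)) / (((-2 : ℤ) : ℝ) + 1) = 1 / s - 1 / q := by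
      norm_num
      ring
    rw [this, div_eq_mul_one_div K s]
    gcongr
    have : 0 < 1 / q := by positivity
    linarith
  have h3 : ν * ‖∫ x in s..q, g x * E x‖ ≤ B / (m * s) + B / (m * s) + K / s := by
    have : ‖(ν : ℂ) * ∫ x in s..q, g x * E x‖ = ν * ‖∫ x in s..q, g x * E x‖ := by
      rw [norm_mul, Complex.norm_real, Real.norm_of_nonneg hν.le]
    rw [← this, ibp]
    exact (norm_sub_le _ _).trans (add_le_add ((norm_sub_le _ _).trans
      (add_le_add (hbd q hq_mem) (hbd s hs_mem))) hint)
  rw [le_div_iff₀ (by positivity)]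
  have h4 : (B / (m * s) + B / (m * s) + K / s) * s = 2 * B / m + K := by field_simp; ring
  calc _ = ν * ‖∫ x in s..q, g x * E x‖ * s := by ring
    _ ≤ (B / (m * s) + B / (m * s) + K / s) * s := by gcongr
    _ = _ := by rw [h4, hK]; ring

lemma norm_integral_gaussian_le {c : ℂ} (hc : 0 < c.re) {s : ℝ} (hs : 0 < s) :
    ‖∫ x in -s..s, Complex.exp (-c * (x : ℂ) ^ 2)‖ ≤ √(Real.pi / ‖c‖) + 3 / (‖c‖ * s) := by
  have hc0 : c ≠ 0 := fun h => by simp [h] at hc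
  have hr : 0 < ‖c‖ := norm_pos_iff.2 hc0
  set G : ℝ → ℂ := fun x => Complex.exp (-c * (x : ℂ) ^ 2) with hG
  have cG : Continuous G := by fun_prop
  have hGd : ∀ x : ℝ, HasDerivAt G ((1 : ℝ) * (-2 * c * x) * G x) x := fun x => by
    have h1 : HasDerivAt (fun x : ℝ => -c * (x : ℂ) ^ 2) (-c * (2 * x)) x := by
      have := ((Complex.ofRealCLM.hasDerivAt (x := x)).pow 2).const_mul (-c)
      simpa using this
    convert h1.cexp using 1
    simp only [hG, Complex.ofReal_one]
    ring
  have hGn : ∀ x : ℝ, ‖G x‖ ≤ 1 := fun x => by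
    simp only [hG]
    rw [Complex.norm_exp, Real.exp_le_one_iff]
    have : (-c * (x : ℂ) ^ 2).re = -(c.re * x ^ 2) := by
      rw [← Complex.ofReal_pow, Complex.re_mul_ofReal, Complex.neg_re]; ring
    rw [this]
    have : 0 ≤ c.re * x ^ 2 := by positivity
    linarith
  have tail : ∀ R, s ≤ R → ‖∫ x in s..R, G x‖ ≤ (3 / 2) / (‖c‖ * s) := fun R hR => by
    have := norm_integral_le_of_linear_phase_deriv (s := s) (q := R) (m := 2 * ‖c‖) (B := 1)
      (B₁ := 0) (B₂ := 2 * ‖c‖) (ν := 1) (E := G) (p := fun x => -2 * c * x)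
      (p₁ := fun _ => -2 * c) (g := fun _ => 1) (g₁ := fun _ => 0) one_pos (by positivity) hs hR
      hGd (fun x => by simpa using (Complex.ofRealCLM.hasDerivAt (x := x)).const_mul (-2 * c))
      (fun x => hasDerivAt_const _ _) continuous_const continuous_const (fun x _ => hGn x)
      (by simp) (by simp) (by simp) (fun x hx => by
        simp [abs_of_pos (hs.trans_le hx.1)])
    simp only [one_mul] at this
    refine this.trans (le_of_eq ?_)
    field_simp
    ring
  have tail' : ∀ R, s ≤ R → ‖∫ x in -R..-s, G x‖ ≤ (3 / 2) / (‖c‖ * s) := fun R hR => by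
    have : ∫ x in -R..-s, G x = ∫ x in s..R, G x := by
      rw [← intervalIntegral.integral_comp_neg]
      simp [hG]
    rw [this]; exact tail R hR
  have hint : Integrable G := integrable_cexp_neg_mul_sq hc
  have hlim : Tendsto (fun R : ℝ => ∫ x in -R..R, G x) atTop (𝓝 (∫ x, G x)) :=
    intervalIntegral_tendsto_integral hint tendsto_neg_atTop_atBot tendsto_id
  have hval : ‖∫ x, G x‖ = √(Real.pi / ‖c‖) := by
    rw [hG, integral_gaussian_complex hc]
    have : (1 / 2 : ℂ) = ((1 / 2 : ℝ) : ℂ) := by norm_num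
    rw [this, Complex.norm_cpow_real, norm_div, Complex.norm_real,
      Real.norm_of_nonneg Real.pi_pos.le, Real.sqrt_eq_rpow]
  rw [← hval]
  refine ge_of_tendsto (hlim.norm.add_const (3 / (‖c‖ * s))) ?_
  filter_upwards [eventually_ge_atTop s] with R hR
  have ii : ∀ a b : ℝ, IntervalIntegrable G volume a b := fun a b => cG.intervalIntegrable a b
  have split : ∫ x in -s..s, G x =
      (∫ x in -R..R, G x) - (∫ x in -R..-s, G x) - ∫ x in s..R, G x := by
    rw [← intervalIntegral.integral_add_adjacent_intervals (ii (-R) (-s)) (ii (-s) R),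
      ← intervalIntegral.integral_add_adjacent_intervals (ii (-s) s) (ii s R)]
    ring
  rw [split]
  refine (norm_sub_le _ _).trans ((add_le_add (norm_sub_le _ _) le_rfl).trans ?_)
  have h1 := tail R hR
  have h2 := tail' R hR
  have h3 : 3 / (‖c‖ * s) = (3 / 2) / (‖c‖ * s) + (3 / 2) / (‖c‖ * s) := by ring
  linarith

lemma norm_fresnel_integral_le {τ s : ℝ} (hτ : 0 < τ) (hs : 0 < s) :
    ‖∫ x in -s..s, Complex.exp (-(τ * Complex.I) * (x : ℂ) ^ 2)‖ ≤
      √(Real.pi / τ) + 3 / (τ * s) := by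
  have hcont : Continuous fun ε : ℝ =>
      ∫ x in -s..s, Complex.exp (-(ε + τ * Complex.I) * (x : ℂ) ^ 2) :=
    intervalIntegral.continuous_parametric_intervalIntegral_of_continuous' (by fun_prop) _ _
  have hlim := (hcont.tendsto 0).norm.mono_left (nhdsWithin_le_nhds (s := Set.Ioi 0))
  simp only [Complex.ofReal_zero, zero_add] at hlim
  refine le_of_tendsto hlim ?_
  filter_upwards [self_mem_nhdsWithin] with ε hε
  have hre : (ε + τ * Complex.I : ℂ).re = ε := by simp
  have him : (ε + τ * Complex.I : ℂ).im = τ := by simp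
  have hn : τ ≤ ‖(ε + τ * Complex.I : ℂ)‖ := by
    have := Complex.abs_im_le_norm (ε + τ * Complex.I : ℂ)
    rw [him] at this
    exact (le_abs_self _).trans this
  refine (norm_integral_gaussian_le (by rw [hre]; exact hε) hs).trans ?_
  have := Real.pi_pos
  gcongr

/-- Quadratic approximation of an oscillating factor near a stationary point of its phase. -/
lemma norm_sub_fresnel_le {θ s B ν : ℝ} {E : ℝ → ℂ} {ψ ψ₁ ψ₂ : ℝ → ℝ}
    (hν : 0 < ν) (hs : 0 < s) (h0 : 0 ≤ θ - s) (hπ : θ + s ≤ Real.pi)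
    (hE : ∀ x, HasDerivAt E (ν * (Complex.I * ψ x) * E x) x)
    (hψ : ∀ x, HasDerivAt ψ (ψ₁ x) x) (hψ₁ : ∀ x, HasDerivAt ψ₁ (ψ₂ x) x)
    (hEb : ∀ x, ‖E x‖ ≤ 1) (hψ₂b : ∀ x ∈ Set.Icc 0 Real.pi, |ψ₂ x| ≤ B) (hψθ : ψ θ = 0)
    {x : ℝ} (hx : x ∈ Set.Icc (-s) s) :
    ‖E (θ + x) - E θ * Complex.exp (-((ν * -ψ₁ θ / 2 : ℝ) * Complex.I) * (x : ℂ) ^ 2)‖ ≤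
      ν * B * s ^ 3 := by
  have hmem : ∀ y ∈ Set.Icc (-s) s, θ + y ∈ Set.Icc 0 Real.pi := fun y hy =>
    ⟨by linarith [hy.1], by linarith [hy.2]⟩
  have hz : (0 : ℝ) ∈ Set.Icc (-s) s := ⟨by linarith, hs.le⟩
  have habs : ∀ y ∈ Set.Icc (-s) s, |y| ≤ s := fun y hy => abs_le.2 hy
  have hB : 0 ≤ B := (abs_nonneg _).trans (hψ₂b _ (hmem 0 hz))
  have h1 : ∀ y ∈ Set.Icc (-s) s, |ψ₁ (θ + y) - ψ₁ θ| ≤ B * s := fun y hy => by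
    have := (convex_Icc (-s) s).norm_image_sub_le_of_norm_hasDerivWithin_le
      (f := fun y => ψ₁ (θ + y)) (f' := fun y => ψ₂ (θ + y)) (C := B)
      (fun z _ => ((hψ₁ (θ + z)).comp_const_add θ z).hasDerivWithinAt)
      (fun z hz => hψ₂b _ (hmem z hz)) hz hy
    simp only [add_zero, sub_zero, Real.norm_eq_abs] at this
    exact this.trans (by gcongr; exact habs y hy)
  have h2 : ∀ y ∈ Set.Icc (-s) s, |ψ (θ + y) - ψ₁ θ * y| ≤ B * s * s := fun y hy => by
    have := (convex_Icc (-s) s).norm_image_sub_le_of_norm_hasDerivWithin_le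
      (f := fun y => ψ (θ + y) - ψ₁ θ * y) (f' := fun y => ψ₁ (θ + y) - ψ₁ θ) (C := B * s)
      (fun z _ => (((hψ (θ + z)).comp_const_add θ z).sub
        (by simpa using (hasDerivAt_id z).const_mul (ψ₁ θ))).hasDerivWithinAt)
      (fun z hz => h1 z hz) hz hy
    simp only [add_zero, sub_zero, Real.norm_eq_abs, hψθ, mul_zero] at this
    exact this.trans (by gcongr; exact habs y hy)
  set τ : ℝ := ν * -ψ₁ θ / 2 with hτ
  have hgd : ∀ z : ℝ, HasDerivAt (fun y : ℝ => Complex.exp (τ * Complex.I * (y : ℂ) ^ 2))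
      (Complex.exp (τ * Complex.I * (z : ℂ) ^ 2) * (τ * Complex.I * (2 * z))) z := fun z => by
    have h1 : HasDerivAt (fun x : ℝ => τ * Complex.I * (x : ℂ) ^ 2)
        (τ * Complex.I * (2 * z)) z := by
      have := ((Complex.ofRealCLM.hasDerivAt (x := z)).pow 2).const_mul (τ * Complex.I)
      simpa using this
    exact h1.cexp
  have hn : ∀ z : ℝ, ‖Complex.exp (τ * Complex.I * (z : ℂ) ^ 2)‖ = 1 := fun z => by
    have : (τ * Complex.I * (z : ℂ) ^ 2) = ((τ * z ^ 2 : ℝ) : ℂ) * Complex.I := by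
      push_cast; ring
    rw [this, Complex.norm_exp_ofReal_mul_I]
  have h3 := (convex_Icc (-s) s).norm_image_sub_le_of_norm_hasDerivWithin_le
      (f := fun y : ℝ => E (θ + y) * Complex.exp (τ * Complex.I * (y : ℂ) ^ 2))
      (C := ν * (B * s * s))
      (fun z _ => (((hE (θ + z)).comp_const_add θ z).mul (hgd z)).hasDerivWithinAt)
      (fun z hz => by
        have e : ν * (Complex.I * ψ (θ + z)) * E (θ + z) *
              Complex.exp (τ * Complex.I * (z : ℂ) ^ 2) +
            E (θ + z) * (Complex.exp (τ * Complex.I * (z : ℂ) ^ 2) *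
              (τ * Complex.I * (2 * z))) =
            ((ν * (ψ (θ + z) - ψ₁ θ * z) : ℝ) : ℂ) * Complex.I * E (θ + z) *
              Complex.exp (τ * Complex.I * (z : ℂ) ^ 2) := by
          have : (τ : ℂ) = ν * -ψ₁ θ / 2 := by rw [hτ]; push_cast; ring
          rw [this]
          push_cast
          ring
        rw [e, norm_mul, hn, norm_mul, norm_mul, Complex.norm_I, Complex.norm_real,
          Real.norm_eq_abs, abs_mul, abs_of_pos hν, mul_one, mul_one]
        calc ν * |ψ (θ + z) - ψ₁ θ * z| * ‖E (θ + z)‖ ≤ ν * (B * s * s) * 1 := by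
              have := h2 z hz
              have := hEb (θ + z)
              gcongr
          _ = _ := mul_one _) hz hx
  have h4 : ‖E (θ + x) - E θ * Complex.exp (-(τ * Complex.I) * (x : ℂ) ^ 2)‖ =
      ‖E (θ + x) * Complex.exp (τ * Complex.I * (x : ℂ) ^ 2) -
        E (θ + 0) * Complex.exp (τ * Complex.I * ((0 : ℝ) : ℂ) ^ 2)‖ := by
    rw [← mul_one ‖E (θ + x) - _‖, ← hn x, ← norm_mul, sub_mul, mul_assoc (E θ),
      ← Complex.exp_add]
    simp
  rw [h4]
  refine h3.trans ?_
  have : ‖x - 0‖ ≤ s := by simpa using habs x hx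
  calc ν * (B * s * s) * ‖x - 0‖ ≤ ν * (B * s * s) * s := by gcongr
    _ = _ := by ring

/-- Quantitative stationary phase on `[0, π]` with a single nondegenerate stationary point. -/
lemma norm_integral_le_of_stationary_phase {θ s m B ν : ℝ} {E g g₁ : ℝ → ℂ} {ψ ψ₁ ψ₂ : ℝ → ℝ}
    (hν : 0 < ν) (hm : 0 < m) (hs : 0 < s) (h0 : 0 ≤ θ - s) (hπ : θ + s ≤ Real.pi)
    (hE : ∀ x, HasDerivAt E (ν * (Complex.I * ψ x) * E x) x)
    (hψ : ∀ x, HasDerivAt ψ (ψ₁ x) x) (hψ₁ : ∀ x, HasDerivAt ψ₁ (ψ₂ x) x)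
    (hg : ∀ x, HasDerivAt g (g₁ x) x) (hg₁ : Continuous g₁)
    (hEb : ∀ x, ‖E x‖ ≤ 1) (hgb : ∀ x, ‖g x‖ ≤ B) (hg₁b : ∀ x, ‖g₁ x‖ ≤ B)
    (hψ₁b : ∀ x ∈ Set.Icc 0 Real.pi, |ψ₁ x| ≤ B) (hψ₂b : ∀ x ∈ Set.Icc 0 Real.pi, |ψ₂ x| ≤ B)
    (hψθ : ψ θ = 0) (hψm : ∀ x ∈ Set.Icc 0 Real.pi, m * |x - θ| ≤ |ψ x|) (hneg : ψ₁ θ < 0) :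
    ‖∫ x in (0 : ℝ)..Real.pi, g x * E x‖ ≤
      ‖g θ‖ * √(2 * Real.pi / (ν * -ψ₁ θ)) + B * (6 / (ν * -ψ₁ θ * s)) +
      2 * s * (B * s + B * (ν * B * s ^ 3)) +
      2 * ((2 * B / m + B * Real.pi / m + B * B / m ^ 2) / (ν * s)) := by
  have hB : 0 ≤ B := (norm_nonneg _).trans (hgb 0)
  have cE : Continuous E := continuous_iff_continuousAt.2 fun x => (hE x).continuousAt
  have cg : Continuous g := continuous_iff_continuousAt.2 fun x => (hg x).continuousAt
  have cψ₁ : Continuous ψ₁ := continuous_iff_continuousAt.2 fun x => (hψ₁ x).continuousAt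
  have ii : ∀ a b : ℝ, IntervalIntegrable (fun x => g x * E x) volume a b :=
    fun a b => (cg.mul cE).intervalIntegrable a b
  have right : ‖∫ x in (θ + s)..Real.pi, g x * E x‖ ≤
      (2 * B / m + B * Real.pi / m + B * B / m ^ 2) / (ν * s) := by
    have hmem : ∀ x ∈ Set.Icc s (Real.pi - θ), θ + x ∈ Set.Icc 0 Real.pi := fun x hx =>
      ⟨by linarith [hx.1], by linarith [hx.2]⟩
    have := norm_integral_le_of_linear_phase_deriv (s := s) (q := Real.pi - θ) (m := m) (B := B)
      (B₁ := B) (B₂ := B) (ν := ν) (E := fun x => E (θ + x))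
      (p := fun x => Complex.I * ψ (θ + x)) (p₁ := fun x => Complex.I * ψ₁ (θ + x))
      (g := fun x => g (θ + x)) (g₁ := fun x => g₁ (θ + x)) hν hm hs (by linarith)
      (fun x => (hE (θ + x)).comp_const_add θ x)
      (fun x => ((hψ (θ + x)).comp_const_add θ x).ofReal_comp.const_mul _)
      (fun x => (hg (θ + x)).comp_const_add θ x) (by fun_prop) (by fun_prop)
      (fun x _ => hEb _) (fun x _ => hgb _) (fun x _ => hg₁b _)
      (fun x hx => by simpa using hψ₁b _ (hmem x hx))
      (fun x hx => by
        have := hψm _ (hmem x hx)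
        rw [add_sub_cancel_left, abs_of_pos (hs.trans_le hx.1)] at this
        simpa using this)
    have e := intervalIntegral.integral_comp_add_left (a := s) (b := Real.pi - θ)
      (fun x => g x * E x) θ
    rw [e, add_sub_cancel] at this
    refine this.trans ?_
    gcongr
    linarith
  have left : ‖∫ x in (0 : ℝ)..(θ - s), g x * E x‖ ≤
      (2 * B / m + B * Real.pi / m + B * B / m ^ 2) / (ν * s) := by
    have hmem : ∀ x ∈ Set.Icc s θ, θ - x ∈ Set.Icc 0 Real.pi := fun x hx =>
      ⟨by linarith [hx.2], by linarith [hx.1]⟩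
    have := norm_integral_le_of_linear_phase_deriv (s := s) (q := θ) (m := m) (B := B)
      (B₁ := B) (B₂ := B) (ν := ν) (E := fun x => E (θ - x))
      (p := fun x => -(Complex.I * ψ (θ - x))) (p₁ := fun x => Complex.I * ψ₁ (θ - x))
      (g := fun x => g (θ - x)) (g₁ := fun x => -g₁ (θ - x)) hν hm hs (by linarith)
      (fun x => ((hE (θ - x)).comp_const_sub θ x).congr_deriv (by ring))
      (fun x => (((hψ (θ - x)).comp_const_sub θ x).ofReal_comp.const_mul
        Complex.I).fun_neg.congr_deriv (by push_cast; ring))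
      (fun x => (hg (θ - x)).comp_const_sub θ x) (by fun_prop) (by fun_prop)
      (fun x _ => hEb _) (fun x _ => hgb _) (fun x _ => by simpa using hg₁b _)
      (fun x hx => by simpa using hψ₁b _ (hmem x hx))
      (fun x hx => by
        have := hψm _ (hmem x hx)
        rw [sub_sub_cancel_left, abs_neg, abs_of_pos (hs.trans_le hx.1)] at this
        simpa using this)
    have e := intervalIntegral.integral_comp_sub_left (a := s) (b := θ)
      (fun x => g x * E x) θ
    rw [e, sub_self] at this
    refine this.trans ?_
    gcongr
    linarith
  set τ : ℝ := ν * -ψ₁ θ / 2 with hτ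
  have hτ0 : 0 < τ := by have := mul_pos hν (neg_pos.2 hneg); rw [hτ]; linarith
  set G : ℝ → ℂ := fun x => Complex.exp (-(τ * Complex.I) * (x : ℂ) ^ 2) with hG
  have cG : Continuous G := by fun_prop
  have mid : ‖∫ x in (θ - s)..(θ + s), g x * E x‖ ≤
      ‖g θ‖ * (√(Real.pi / τ) + 3 / (τ * s)) + 2 * s * (B * s + B * (ν * B * s ^ 3)) := by
    have e : ∫ x in (θ - s)..(θ + s), g x * E x = ∫ x in -s..s, g (θ + x) * E (θ + x) := by
      rw [intervalIntegral.integral_comp_add_left (fun x => g x * E x) θ]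
      rfl
    have hd : ∀ x ∈ Set.uIoc (-s) s,
        ‖g (θ + x) * E (θ + x) - g θ * E θ * G x‖ ≤ B * s + B * (ν * B * s ^ 3) := by
      intro x hx
      rw [Set.uIoc_of_le (by linarith)] at hx
      have hx' : x ∈ Set.Icc (-s) s := ⟨hx.1.le, hx.2⟩
      have k1 := norm_sub_fresnel_le hν hs h0 hπ hE hψ hψ₁ hEb hψ₂b hψθ hx'
      have k2 : ‖g (θ + x) - g θ‖ ≤ B * s := by
        have := convex_univ.norm_image_sub_le_of_norm_hasDerivWithin_le (x := θ) (y := θ + x)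
          (fun z _ => (hg z).hasDerivWithinAt) (fun z _ => hg₁b z) trivial trivial
        rw [add_sub_cancel_left] at this
        exact this.trans (by gcongr; exact abs_le.2 hx')
      have : g (θ + x) * E (θ + x) - g θ * E θ * G x =
          (g (θ + x) - g θ) * E (θ + x) + g θ * (E (θ + x) - E θ * G x) := by ring
      rw [this]
      refine (norm_add_le _ _).trans (add_le_add ?_ ?_)
      · rw [norm_mul]
        calc _ ≤ B * s * 1 := by gcongr; exact hEb _
          _ = _ := mul_one _
      · rw [norm_mul]
        gcongr
        exact hgb _
    have h1 := intervalIntegral.norm_integral_le_of_norm_le_const hd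
    rw [intervalIntegral.integral_sub
      (Continuous.intervalIntegrable (by fun_prop) _ _)
      (Continuous.intervalIntegrable (by fun_prop) _ _), intervalIntegral.integral_const_mul,
      ← e] at h1
    have h2 : |s - -s| = 2 * s := by rw [abs_of_pos (by linarith)]; ring
    have h3 : ‖g θ * E θ * ∫ x in -s..s, G x‖ ≤ ‖g θ‖ * (√(Real.pi / τ) + 3 / (τ * s)) := by
      rw [norm_mul, norm_mul]
      have := norm_fresnel_integral_le hτ0 hs
      calc _ ≤ ‖g θ‖ * 1 * (√(Real.pi / τ) + 3 / (τ * s)) := by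
            gcongr
            exact hEb _
        _ = _ := by rw [mul_one]
    rw [h2] at h1
    have h4 := norm_le_norm_add_norm_sub' (∫ x in (θ - s)..(θ + s), g x * E x)
      (g θ * E θ * ∫ x in -s..s, G x)
    linarith
  have split : ∫ x in (0 : ℝ)..Real.pi, g x * E x = (∫ x in (0 : ℝ)..(θ - s), g x * E x) +
      (∫ x in (θ - s)..(θ + s), g x * E x) + ∫ x in (θ + s)..Real.pi, g x * E x := by
    rw [intervalIntegral.integral_add_adjacent_intervals (ii _ _) (ii _ _),
      intervalIntegral.integral_add_adjacent_intervals (ii _ _) (ii _ _)]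
  have h5 : Real.pi / τ = 2 * Real.pi / (ν * -ψ₁ θ) := by
    rw [hτ]; field_simp
  have h6 : 3 / (τ * s) = 6 / (ν * -ψ₁ θ * s) := by
    rw [hτ]; field_simp; norm_num
  have h7 : ‖g θ‖ * (6 / (ν * -ψ₁ θ * s)) ≤ B * (6 / (ν * -ψ₁ θ * s)) := by
    have := mul_pos (mul_pos hν (neg_pos.2 hneg)) hs
    gcongr
    exact hgb θ
  rw [h5, h6, mul_add] at mid
  rw [split]
  have h8 := norm_add₃_le (a := ∫ x in (0 : ℝ)..(θ - s), g x * E x)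
    (b := ∫ x in (θ - s)..(θ + s), g x * E x) (c := ∫ x in (θ + s)..Real.pi, g x * E x)
  linarith

/-- Cauchy's formula on the unit circle for the coefficients of a power series. -/
lemma coeff_eq_integral_exp {f : ℂ → ℂ} {a : ℕ → ℂ}
    (hf : DifferentiableOn ℂ f (Metric.closedBall 0 1))
    (ha : ∀ z : ℂ, ‖z‖ < 1 → HasSum (fun k => a k * z ^ k) (f z)) (k : ℕ) :
    a k = (2 * Real.pi : ℂ)⁻¹ * ∫ θ in (0 : ℝ)..(2 * Real.pi),
      f (Complex.exp (θ * Complex.I)) * Complex.exp (-(k * θ * Complex.I)) := by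
  have h1 : HasFPowerSeriesAt f (FormalMultilinearSeries.ofScalars ℂ a) 0 := by
    rw [hasFPowerSeriesAt_iff]
    filter_upwards [Metric.ball_mem_nhds (0 : ℂ) one_pos] with z hz
    have := ha z (by simpa using hz)
    simpa [FormalMultilinearSeries.coeff_ofScalars, mul_comm] using this
  have h2 := (DifferentiableOn.hasFPowerSeriesOnBall (R := 1) (by simpa using hf)
    one_pos).hasFPowerSeriesAt
  have h3 := congrArg (fun p => FormalMultilinearSeries.coeff p k)
    (h1.eq_formalMultilinearSeries h2)
  simp only [FormalMultilinearSeries.coeff_ofScalars] at h3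
  rw [h3, FormalMultilinearSeries.coeff, show (1 : Fin k → ℂ) = fun _ => 1 from rfl,
    cauchyPowerSeries_apply, circleIntegral, smul_eq_mul, mul_inv, mul_assoc,
    ← intervalIntegral.integral_const_mul]
  congr 1
  refine intervalIntegral.integral_congr fun θ _ => ?_
  have h0 := Complex.exp_ne_zero (θ * Complex.I)
  have h4 : Complex.exp (-(k * θ * Complex.I)) = (Complex.exp (θ * Complex.I) ^ k)⁻¹ := by
    rw [Complex.exp_neg, ← Complex.exp_nat_mul, mul_assoc]
  simp only [circleMap, deriv_circleMap, NNReal.coe_one, Complex.ofReal_one, one_mul, zero_add,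
    sub_zero, smul_eq_mul, h4]
  rw [one_div, inv_pow]
  field_simp

/-- For a real power series only the upper half of the unit circle matters. -/
lemma norm_coeff_le_norm_integral {f : ℂ → ℂ} {a : ℕ → ℂ}
    (hf : DifferentiableOn ℂ f (Metric.closedBall 0 1))
    (ha : ∀ z : ℂ, ‖z‖ < 1 → HasSum (fun k => a k * z ^ k) (f z))
    (hconj : ∀ z, f (starRingEnd ℂ z) = starRingEnd ℂ (f z)) (k : ℕ) :
    ‖a k‖ ≤ Real.pi⁻¹ * ‖∫ θ in (0 : ℝ)..Real.pi,
      f (Complex.exp (θ * Complex.I)) * Complex.exp (-(k * θ * Complex.I))‖ := by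
  set G : ℝ → ℂ := fun θ =>
    f (Complex.exp (θ * Complex.I)) * Complex.exp (-(k * θ * Complex.I)) with hG
  have cG : Continuous G := by
    have : Continuous fun θ : ℝ => f (Complex.exp (θ * Complex.I)) :=
      hf.continuousOn.comp_continuous (by fun_prop) fun θ => by
        simp [Complex.norm_exp_ofReal_mul_I]
    exact this.mul (by fun_prop)
  have hsymm : ∀ θ, G (2 * Real.pi - θ) = starRingEnd ℂ (G θ) := fun θ => by
    have h1 : Complex.exp (((2 * Real.pi - θ : ℝ) : ℂ) * Complex.I) =
        starRingEnd ℂ (Complex.exp (θ * Complex.I)) := by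
      rw [← Complex.exp_conj]
      simp only [map_mul, Complex.conj_ofReal, Complex.conj_I]
      rw [← Complex.exp_periodic (θ * -Complex.I)]
      congr 1
      push_cast
      ring
    have h2 : Complex.exp (-(k * ((2 * Real.pi - θ : ℝ) : ℂ) * Complex.I)) =
        starRingEnd ℂ (Complex.exp (-(k * θ * Complex.I))) := by
      rw [← Complex.exp_conj]
      simp only [map_mul, map_neg, Complex.conj_ofReal, Complex.conj_I, map_natCast]
      rw [← (Complex.exp_periodic.nat_mul k)]
      congr 1
      push_cast
      ring
    simp only [hG]
    rw [h1, h2, hconj, map_mul]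
  have hsecond : ∫ θ in Real.pi..(2 * Real.pi), G θ =
      starRingEnd ℂ (∫ θ in (0 : ℝ)..Real.pi, G θ) := by
    have := intervalIntegral.integral_comp_sub_left (a := 0) (b := Real.pi) G (2 * Real.pi)
    rw [sub_zero, show 2 * Real.pi - Real.pi = Real.pi by ring] at this
    rw [← this, ← intervalIntegral.intervalIntegral_conj]
    exact intervalIntegral.integral_congr fun θ _ => hsymm θ
  rw [coeff_eq_integral_exp hf ha k, ← intervalIntegral.integral_add_adjacent_intervals
    (cG.intervalIntegrable 0 Real.pi) (cG.intervalIntegrable Real.pi (2 * Real.pi)), hsecond,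
    norm_mul]
  have h3 := norm_add_le (∫ θ in (0 : ℝ)..Real.pi, G θ)
    (starRingEnd ℂ (∫ θ in (0 : ℝ)..Real.pi, G θ))
  rw [RCLike.norm_conj] at h3
  have hpi := Real.pi_pos
  have h4 : ‖(2 * Real.pi : ℂ)⁻¹‖ = (2 * Real.pi)⁻¹ := by
    rw [norm_inv, norm_mul, Complex.norm_real, Real.norm_of_nonneg hpi.le]
    simp
  rw [h4]
  calc _ ≤ (2 * Real.pi)⁻¹ * (‖∫ θ in (0 : ℝ)..Real.pi, G θ‖ + ‖∫ θ in (0 : ℝ)..Real.pi, G θ‖) := by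
        gcongr
    _ = _ := by field_simp; ring

lemma poisson_denom_pos {l : ℝ} (hl : l ∈ Set.Ioo (0 : ℝ) 1) (θ : ℝ) :
    0 < 1 + l ^ 2 - 2 * l * Real.cos θ := by
  have := Real.cos_le_one θ
  nlinarith [hl.1, hl.2, mul_nonneg hl.1.le (sub_nonneg.2 this), sq_pos_of_pos (sub_pos.2 hl.2)]

lemma poisson_denom_le_four {l : ℝ} (hl : l ∈ Set.Ioo (0 : ℝ) 1) (θ : ℝ) :
    1 + l ^ 2 - 2 * l * Real.cos θ ≤ 4 := by
  have := Real.neg_one_le_cos θ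
  nlinarith [hl.1, hl.2]

/-- The argument of a Blaschke factor on the unit circle has the Poisson kernel as derivative. -/
lemma hasDerivAt_blaschke_exp {l : ℝ} (hl : l ∈ Set.Ioo (0 : ℝ) 1) (θ : ℝ) :
    HasDerivAt (fun θ : ℝ => (Complex.exp (θ * Complex.I) - l) / (1 - l * Complex.exp (θ * Complex.I)))
      (Complex.I * ((1 - l ^ 2) / (1 + l ^ 2 - 2 * l * Real.cos θ) : ℝ) *
        ((Complex.exp (θ * Complex.I) - l) / (1 - l * Complex.exp (θ * Complex.I)))) θ := by
  have hz : HasDerivAt (fun θ : ℝ => Complex.exp (θ * Complex.I))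
      (Complex.exp (θ * Complex.I) * Complex.I) θ := by
    have : HasDerivAt (fun θ : ℝ => (θ : ℂ) * Complex.I) Complex.I θ := by
      simpa using (Complex.ofRealCLM.hasDerivAt (x := θ)).mul_const Complex.I
    exact this.cexp
  set z := Complex.exp (θ * Complex.I) with hzdef
  set y := Complex.exp (-θ * Complex.I) with hy
  have hzy : z * y = 1 := by
    rw [hzdef, hy, ← Complex.exp_add]; simp
  have hD : ((1 + l ^ 2 - 2 * l * Real.cos θ : ℝ) : ℂ) = (1 - l * z) * (1 - l * y) := by
    push_cast
    rw [Complex.cos, ← hzdef, ← hy]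
    linear_combination (-(l : ℂ) ^ 2) * hzy
  have hD0 : (1 - l * z) * (1 - l * y) ≠ 0 := by
    rw [← hD]; exact_mod_cast (poisson_denom_pos hl θ).ne'
  have h1 := left_ne_zero_of_mul hD0
  have h2 := right_ne_zero_of_mul hD0
  refine ((hz.sub_const (l : ℂ)).div ((hz.const_mul (l : ℂ)).const_sub 1) h1).congr_deriv ?_
  rw [Complex.ofReal_div, hD]
  have h3 : (z - l) = z * (1 - l * y) := by linear_combination (l : ℂ) * hzy
  have h4 : z * Complex.I * (1 - l * z) - (z - l) * -(l * (z * Complex.I)) =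
      Complex.I * z * (1 - l ^ 2) := by ring
  rw [← hzdef, h4, h3]
  push_cast
  field_simp

lemma norm_blaschke_exp {l : ℝ} (hl : l ∈ Set.Ioo (0 : ℝ) 1) (θ : ℝ) :
    ‖(Complex.exp (θ * Complex.I) - l) / (1 - l * Complex.exp (θ * Complex.I))‖ = 1 := by
  set z := Complex.exp (θ * Complex.I) with hz
  have hzn : ‖z‖ = 1 := Complex.norm_exp_ofReal_mul_I θ
  have h1 : (1 - l * z) ≠ 0 := fun h => by
    have : (l : ℂ) * z = 1 := (sub_eq_zero.1 h).symm
    have := congrArg norm this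
    rw [norm_mul, hzn, Complex.norm_real, Real.norm_of_nonneg hl.1.le, norm_one, mul_one] at this
    exact absurd this hl.2.ne
  have h2 : ‖z - l‖ = ‖1 - l * z‖ := by
    have e : z - l = z * starRingEnd ℂ (1 - l * z) := by
      have : z * starRingEnd ℂ z = 1 := by
        rw [Complex.mul_conj, Complex.normSq_eq_norm_sq, hzn]; simp
      simp only [map_sub, map_one, map_mul, Complex.conj_ofReal]
      linear_combination (l : ℂ) * this
    rw [e, norm_mul, hzn, one_mul, RCLike.norm_conj]
  rw [norm_div, h2, div_self]
  exact norm_ne_zero_iff.2 h1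

lemma sin_mul_abs_sub_le_abs_cos_sub {x y : ℝ} (hx : x ∈ Set.Icc 0 Real.pi)
    (hy : y ∈ Set.Icc 0 Real.pi) :
    Real.sin y * |x - y| / Real.pi ≤ |Real.cos x - Real.cos y| := by
  have hpi := Real.pi_pos
  have e : Real.sin y = 2 * Real.sin (y / 2) * Real.cos (y / 2) := by
    rw [← Real.sin_two_mul]; ring_nf
  have s1 : 0 ≤ Real.sin (x / 2) :=
    Real.sin_nonneg_of_nonneg_of_le_pi (by linarith [hx.1]) (by linarith [hx.2])
  have s2 : 0 ≤ Real.sin (y / 2) :=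
    Real.sin_nonneg_of_nonneg_of_le_pi (by linarith [hy.1]) (by linarith [hy.2])
  have c1 : 0 ≤ Real.cos (x / 2) :=
    Real.cos_nonneg_of_mem_Icc ⟨by linarith [hx.1], by linarith [hx.2]⟩
  have c2 : 0 ≤ Real.cos (y / 2) :=
    Real.cos_nonneg_of_mem_Icc ⟨by linarith [hy.1], by linarith [hy.2]⟩
  have h1 : Real.sin y / 2 ≤ Real.sin ((x + y) / 2) := by
    rw [add_div, Real.sin_add, e]
    have hxy : 1 ≤ Real.sin (x / 2) + Real.cos (x / 2) := by
      nlinarith [Real.sin_sq_add_cos_sq (x / 2), mul_nonneg s1 c1]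
    have k1 : Real.sin (y / 2) * Real.cos (y / 2) ≤ Real.cos (y / 2) :=
      mul_le_of_le_one_left c2 (Real.sin_le_one _)
    have k2 : Real.sin (y / 2) * Real.cos (y / 2) ≤ Real.sin (y / 2) :=
      mul_le_of_le_one_right s2 (Real.cos_le_one _)
    have k3 := mul_le_mul_of_nonneg_left k1 s1
    have k4 := mul_le_mul_of_nonneg_left k2 c1
    have k5 := mul_le_mul_of_nonneg_right hxy (mul_nonneg s2 c2)
    linarith
  have h2 : |x - y| / Real.pi ≤ |Real.sin ((x - y) / 2)| := by
    have hb : |(x - y) / 2| ≤ Real.pi / 2 := by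
      rw [abs_div, abs_two]
      have : |x - y| ≤ Real.pi := abs_le.2 ⟨by linarith [hx.1, hy.2], by linarith [hx.2, hy.1]⟩
      linarith
    have := Real.mul_abs_le_abs_sin hb
    rw [abs_div, abs_two] at this
    calc _ = 2 / Real.pi * (|x - y| / 2) := by ring
      _ ≤ _ := this
  have hsy : 0 ≤ Real.sin y := Real.sin_nonneg_of_mem_Icc hy
  rw [Real.cos_sub_cos, abs_mul, abs_mul, abs_neg, abs_two, abs_of_nonneg (by linarith :
    0 ≤ Real.sin ((x + y) / 2))]
  calc _ = 2 * (Real.sin y / 2) * (|x - y| / Real.pi) := by ring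
    _ ≤ _ := by
      have : 0 ≤ Real.sin ((x + y) / 2) := by linarith
      gcongr

lemma norm_integral_blaschke_le {l : ℝ} (hl : l ∈ Set.Ioo (0 : ℝ) 1) {σ : ℝ} (hσ : 0 < σ) :
    ∃ C : ℝ, ∀ n k : ℕ, ∀ θ ∈ Set.Icc 0 Real.pi, ∀ t : ℝ, 0 < t → t ≤ 1 →
      t ^ 4 ≤ σ → (n : ℝ) = (t ^ 10)⁻¹ → σ ≤ Real.sin θ →
      (k : ℝ) / n = (1 - l ^ 2) / (1 + l ^ 2 - 2 * l * Real.cos θ) →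
      ‖∫ x in (0 : ℝ)..Real.pi, (1 - Complex.exp (x * Complex.I) ^ 2) *
          (((Complex.exp (x * Complex.I) - l) / (1 - l * Complex.exp (x * Complex.I))) ^ n *
            Complex.exp (-(k * x * Complex.I)))‖ ≤
        2 * Real.sin θ * √(2 * Real.pi / (n * ((1 - l ^ 2) * (2 * l * Real.sin θ) /
          (1 + l ^ 2 - 2 * l * Real.cos θ) ^ 2))) + C * t ^ 6 := by
  have hpi := Real.pi_pos
  have hκ : 0 < 1 - l ^ 2 := by nlinarith [hl.1, hl.2]
  have hl0 := hl.1
  set D : ℝ → ℝ := fun x => 1 + l ^ 2 - 2 * l * Real.cos x with hD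
  have hDpos : ∀ x, 0 < D x := poisson_denom_pos hl
  have hD4 : ∀ x, D x ≤ 4 := poisson_denom_le_four hl
  have hDd : ∀ x, HasDerivAt D (2 * l * Real.sin x) x := fun x =>
    (((Real.hasDerivAt_cos x).const_mul (2 * l)).const_sub (1 + l ^ 2)).congr_deriv (by ring)
  set ψ₁ : ℝ → ℝ := fun x => -((1 - l ^ 2) * (2 * l * Real.sin x) / D x ^ 2) with hψ₁
  set ψ₂ : ℝ → ℝ := fun x => -(((1 - l ^ 2) * (2 * l * Real.cos x) * D x ^ 2 -
    (1 - l ^ 2) * (2 * l * Real.sin x) * (2 * D x * (2 * l * Real.sin x))) / (D x ^ 2) ^ 2) with hψ₂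
  have hψ₁d : ∀ x, HasDerivAt ψ₁ (ψ₂ x) x := fun x => by
    have h1 := ((Real.hasDerivAt_sin x).const_mul (2 * l)).const_mul (1 - l ^ 2)
    have h2 := (hDd x).fun_pow 2
    exact ((h1.fun_div h2 (pow_ne_zero _ (hDpos x).ne')).fun_neg).congr_deriv (by
      simp only [hψ₂]; norm_num)
  have cD : Continuous D := by fun_prop
  have cψ₁ : Continuous ψ₁ := continuous_iff_continuousAt.2 fun x => (hψ₁d x).continuousAt
  have cψ₂ : Continuous ψ₂ :=
    (Continuous.div (by fun_prop) (by fun_prop) fun x => by have := hDpos x; positivity).neg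
  obtain ⟨B₁, hB₁⟩ := isCompact_Icc.exists_bound_of_continuousOn
    (s := Set.Icc 0 Real.pi) cψ₁.continuousOn
  obtain ⟨B₂, hB₂⟩ := isCompact_Icc.exists_bound_of_continuousOn
    (s := Set.Icc 0 Real.pi) cψ₂.continuousOn
  set B := max 2 (max B₁ B₂) with hB
  have hB2 : 2 ≤ B := le_max_left _ _
  have hBB₁ : B₁ ≤ B := (le_max_left _ _).trans (le_max_right _ _)
  have hBB₂ : B₂ ≤ B := (le_max_right _ _).trans (le_max_right _ _)
  set b₀ := (1 - l ^ 2) * (2 * l * σ) / 16 with hb₀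
  have hb₀pos : 0 < b₀ := by positivity
  set m := b₀ / Real.pi with hm
  have hmpos : 0 < m := by positivity
  set K := 2 * B / m + B * Real.pi / m + B * B / m ^ 2 with hK
  refine ⟨6 * B / b₀ + (2 * B + 2 * B ^ 2) + 2 * K, ?_⟩
  intro n k θ hθ t ht ht1 htσ hnt hsin hkn
  have hn : (0 : ℝ) < n := by rw [hnt]; positivity
  have hn' : (n : ℂ) ≠ 0 := by exact_mod_cast hn.ne'
  set ψ : ℝ → ℝ := fun x => (1 - l ^ 2) / D x - (k : ℝ) / n with hψ
  have hψd : ∀ x, HasDerivAt ψ (ψ₁ x) x := fun x => by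
    have := (((hasDerivAt_const x (1 - l ^ 2)).fun_div (hDd x) (hDpos x).ne').sub_const
      ((k : ℝ) / n))
    exact this.congr_deriv (by simp only [hψ₁]; ring)
  have hs : 0 < t ^ 4 := by positivity
  have hsθ : t ^ 4 ≤ θ := htσ.trans (hsin.trans (Real.sin_le hθ.1))
  have hsπ : t ^ 4 ≤ Real.pi - θ := by
    rw [← Real.sin_pi_sub] at hsin
    exact htσ.trans (hsin.trans (Real.sin_le (by linarith [hθ.2])))
  have hb : b₀ ≤ -ψ₁ θ := by
    simp only [hψ₁, neg_neg, hb₀]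
    have h1 : D θ ^ 2 ≤ 16 := by nlinarith [hDpos θ, hD4 θ]
    have h2 := pow_pos (hDpos θ) 2
    have h3 := hσ.trans_le hsin
    gcongr
  have hdiff : ∀ x, ψ x = (1 - l ^ 2) * (2 * l) * (Real.cos x - Real.cos θ) / (D x * D θ) := by
    intro x
    have h1 := (hDpos x).ne'
    have h2 := (hDpos θ).ne'
    have : ψ x = (1 - l ^ 2) / D x - (1 - l ^ 2) / D θ := by
      simp only [hψ]; rw [hkn]
    rw [this, div_sub_div _ _ h1 h2]
    congr 1
    simp only [hD]
    ring
  set w : ℝ → ℂ := fun x =>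
    (Complex.exp (x * Complex.I) - l) / (1 - l * Complex.exp (x * Complex.I)) with hw
  have hE : ∀ x : ℝ, HasDerivAt (fun x : ℝ => w x ^ n * Complex.exp (-(k * x * Complex.I)))
      (((n : ℝ) : ℂ) * (Complex.I * ψ x) * (w x ^ n * Complex.exp (-(k * x * Complex.I)))) x := by
    intro x
    have h1 : HasDerivAt w (Complex.I * ((1 - l ^ 2) / D x : ℝ) * w x) x :=
      hasDerivAt_blaschke_exp hl x
    have h2 : HasDerivAt (fun x : ℝ => -((k : ℂ) * x * Complex.I)) (-(k * Complex.I)) x := by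
      simpa using (((Complex.ofRealCLM.hasDerivAt (x := x)).const_mul (k : ℂ)).mul_const
        Complex.I).fun_neg
    have hn1 : w x ^ n = w x ^ (n - 1) * w x := by
      have : n ≠ 0 := by exact_mod_cast hn'
      rw [← pow_succ, Nat.sub_add_cancel (Nat.one_le_iff_ne_zero.2 this)]
    refine ((h1.fun_pow n).fun_mul h2.cexp).congr_deriv ?_
    rw [hn1]
    simp only [hψ]
    push_cast
    field_simp
    ring
  have hexp : ∀ x : ℝ, HasDerivAt (fun x : ℝ => Complex.exp (x * Complex.I))
      (Complex.exp (x * Complex.I) * Complex.I) x := fun x => by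
    have : HasDerivAt (fun θ : ℝ => (θ : ℂ) * Complex.I) Complex.I x := by
      simpa using (Complex.ofRealCLM.hasDerivAt (x := x)).mul_const Complex.I
    exact this.cexp
  have hg : ∀ x : ℝ, HasDerivAt (fun x : ℝ => 1 - Complex.exp (x * Complex.I) ^ 2)
      (-(2 * Complex.exp (x * Complex.I) ^ 2 * Complex.I)) x := fun x =>
    (((hexp x).fun_pow 2).const_sub 1).congr_deriv (by push_cast; ring)
  have hgθ : ‖1 - Complex.exp (θ * Complex.I) ^ 2‖ = 2 * Real.sin θ := by
    have h0 : 0 ≤ Real.sin θ := Real.sin_nonneg_of_mem_Icc hθ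
    have e : 1 - Complex.exp (θ * Complex.I) ^ 2 =
        ((2 * Real.sin θ : ℝ) : ℂ) * (Complex.exp (θ * Complex.I) * -Complex.I) := by
      have h1 := Complex.sin_sq_add_cos_sq (θ : ℂ)
      rw [Complex.exp_mul_I]
      push_cast
      linear_combination -h1 +
        (Complex.sin θ ^ 2) * Complex.I_sq
    rw [e, norm_mul, norm_mul, Complex.norm_exp_ofReal_mul_I, norm_neg, Complex.norm_I,
      Complex.norm_real, Real.norm_of_nonneg (by linarith)]
    ring
  have main := norm_integral_le_of_stationary_phase (θ := θ) (s := t ^ 4) (m := m) (B := B)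
    (ν := n) (E := fun x : ℝ => w x ^ n * Complex.exp (-(k * x * Complex.I)))
    (ψ := ψ) (ψ₁ := ψ₁) (ψ₂ := ψ₂) hn hmpos hs (by linarith) (by linarith) hE hψd hψ₁d hg
    (by fun_prop) (fun x => by
      have h1 : Complex.exp (-(k * x * Complex.I)) =
          Complex.exp (((-(k * x) : ℝ) : ℂ) * Complex.I) := by
        congr 1; push_cast; ring
      rw [norm_mul, norm_pow, norm_blaschke_exp hl x, h1, Complex.norm_exp_ofReal_mul_I]
      simp)
    (fun x => by
      refine (norm_sub_le _ _).trans ?_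
      rw [norm_pow, Complex.norm_exp_ofReal_mul_I, norm_one]
      linarith)
    (fun x => by
      rw [norm_neg, norm_mul, norm_mul, norm_pow, Complex.norm_exp_ofReal_mul_I]
      simpa using hB2)
    (fun x hx => (hB₁ x hx).trans hBB₁) (fun x hx => (hB₂ x hx).trans hBB₂)
    (by rw [hdiff]; simp)
    (fun x hx => by
      have h1 := sin_mul_abs_sub_le_abs_cos_sub hx hθ
      have h2 : 0 < D x * D θ := mul_pos (hDpos x) (hDpos θ)
      have h3 : D x * D θ ≤ 16 := by nlinarith [hDpos x, hD4 x, hDpos θ, hD4 θ]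
      rw [hdiff, abs_div, abs_mul, abs_of_pos h2,
        abs_of_pos (by positivity : 0 < (1 - l ^ 2) * (2 * l))]
      calc m * |x - θ| = (1 - l ^ 2) * (2 * l) * (σ * |x - θ| / Real.pi) / 16 := by
            rw [hm, hb₀]; ring
        _ ≤ (1 - l ^ 2) * (2 * l) * |Real.cos x - Real.cos θ| / (D x * D θ) := by
            have : σ * |x - θ| / Real.pi ≤ |Real.cos x - Real.cos θ| :=
              le_trans (by gcongr) h1
            gcongr)
    (by linarith)
  rw [hgθ] at main
  refine main.trans ?_
  have hB0 : 0 < B := by linarith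
  have e1 : B * (6 / (n * -ψ₁ θ * t ^ 4)) ≤ 6 * B / b₀ * t ^ 6 := by
    calc _ ≤ B * (6 / (n * b₀ * t ^ 4)) := by gcongr
      _ = _ := by rw [hnt]; field_simp
  have e2 : 2 * t ^ 4 * (B * t ^ 4 + B * (n * B * (t ^ 4) ^ 3)) ≤ (2 * B + 2 * B ^ 2) * t ^ 6 := by
    have : (n : ℝ) * (t ^ 4) ^ 3 = t ^ 2 := by rw [hnt]; field_simp
    have h8 : t ^ 8 ≤ t ^ 6 := pow_le_pow_of_le_one ht.le ht1 (by norm_num)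
    calc _ = 2 * B * t ^ 8 + 2 * B ^ 2 * t ^ 4 * (n * (t ^ 4) ^ 3) := by ring
      _ = 2 * B * t ^ 8 + 2 * B ^ 2 * t ^ 6 := by rw [this]; ring
      _ ≤ 2 * B * t ^ 6 + 2 * B ^ 2 * t ^ 6 := by gcongr
      _ = _ := by ring
  have e3 : 2 * (K / (n * t ^ 4)) = 2 * K * t ^ 6 := by rw [hnt]; field_simp
  have e4 : -ψ₁ θ = (1 - l ^ 2) * (2 * l * Real.sin θ) / D θ ^ 2 := by simp [hψ₁]
  rw [e3, e4]
  rw [e4] at e1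
  linarith

lemma exists_stationary_angle {l α a : ℝ} (hl : l ∈ Set.Ioo (0 : ℝ) 1)
    (hα : α = (1 - l) / (1 + l)) (ha : 0 < a) (hu : 0 ≤ a - α) (hv : 0 ≤ α⁻¹ - a) :
    ∃ θ ∈ Set.Icc 0 Real.pi, 1 + l ^ 2 - 2 * l * Real.cos θ = (1 - l ^ 2) / a ∧
      Real.sin θ ^ 2 = (1 - l ^ 2) ^ 2 / (4 * l ^ 2 * a ^ 2) * ((a - α) * (α⁻¹ - a)) := by
  obtain ⟨hl0, hl1⟩ := hl
  have hl1' : 0 < 1 - l := by linarith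
  set y : ℝ := (1 + l ^ 2 - (1 - l ^ 2) / a) / (2 * l) with hy
  have hsq : 1 - y ^ 2 = (1 - l ^ 2) ^ 2 / (4 * l ^ 2 * a ^ 2) * ((a - α) * (α⁻¹ - a)) := by
    rw [hα, inv_div, hy]
    have : (1 + l) ≠ 0 := by positivity
    have := hl1'.ne'
    field_simp
    ring
  have hy2 : 0 ≤ 1 - y ^ 2 := by rw [hsq]; positivity
  have hyabs : |y| ≤ 1 := by
    rw [← sq_le_one_iff_abs_le_one]; linarith
  have hcos : Real.cos (Real.arccos y) = y :=
    Real.cos_arccos (abs_le.1 hyabs).1 (abs_le.1 hyabs).2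
  refine ⟨Real.arccos y, ⟨Real.arccos_nonneg _, Real.arccos_le_pi _⟩, ?_, ?_⟩
  · rw [hcos, hy]
    field_simp
    ring
  · rw [Real.sin_sq, hcos, hsq]

lemma norm_coeff_le_norm_integral_blaschke {l : ℝ} (hl : l ∈ Set.Ioo (0 : ℝ) 1) {n : ℕ}
    {a : ℕ → ℂ} (ha : ∀ z : ℂ, ‖z‖ < 1 → HasSum (fun k => a k * z ^ k)
      ((1 - z ^ 2) * ((z - (l : ℂ)) / (1 - (l : ℂ) * z)) ^ n)) (k : ℕ) :
    ‖a k‖ ≤ Real.pi⁻¹ * ‖∫ x in (0 : ℝ)..Real.pi, (1 - Complex.exp (x * Complex.I) ^ 2) *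
      (((Complex.exp (x * Complex.I) - l) / (1 - l * Complex.exp (x * Complex.I))) ^ n *
        Complex.exp (-(k * x * Complex.I)))‖ := by
  have h0 : ∀ z ∈ Metric.closedBall (0 : ℂ) 1, 1 - (l : ℂ) * z ≠ 0 := fun z hz h => by
    have h1 : ‖(l : ℂ) * z‖ = 1 := by rw [← sub_eq_zero.1 h, norm_one]
    rw [norm_mul, Complex.norm_real, Real.norm_of_nonneg hl.1.le] at h1
    have h2 : ‖z‖ ≤ 1 := by simpa using hz
    nlinarith [hl.1, hl.2]
  have hf : DifferentiableOn ℂ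
      (fun z => (1 - z ^ 2) * ((z - (l : ℂ)) / (1 - (l : ℂ) * z)) ^ n)
      (Metric.closedBall 0 1) := by
    have h1 : DifferentiableOn ℂ (fun z => (z - (l : ℂ)) / (1 - (l : ℂ) * z))
        (Metric.closedBall 0 1) := DifferentiableOn.fun_div (by fun_prop) (by fun_prop) h0
    exact DifferentiableOn.fun_mul (by fun_prop) (h1.fun_pow n)
  have := norm_coeff_le_norm_integral hf ha (fun z => by simp) k
  simpa only [mul_assoc] using this

/-- The stationary phase amplitude in terms of the ratio `a = k / n`. -/
lemma stationary_amplitude_eq {l a u v S ν : ℝ} (hl : l ∈ Set.Ioo (0 : ℝ) 1) (ha : 0 < a)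
    (hu : 0 ≤ u) (hv : 0 ≤ v) (hν : 0 < ν) (hS : 0 < S)
    (hS2 : S ^ 2 = (1 - l ^ 2) ^ 2 / (4 * l ^ 2 * a ^ 2) * (u * v)) :
    Real.pi⁻¹ * (2 * S * √(2 * Real.pi / (ν * ((1 - l ^ 2) * (2 * l * S) /
      ((1 - l ^ 2) / a) ^ 2)))) =
    √(1 - l ^ 2) * (√(2 * (1 - l ^ 2) / (Real.pi * ν)) * u ^ ((1 : ℝ) / 4) * v ^ ((1 : ℝ) / 4) /
      (l * a ^ ((3 : ℝ) / 2))) := by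
  have hpi := Real.pi_pos
  have hl0 := hl.1
  have hκ : 0 < 1 - l ^ 2 := by nlinarith [hl.1, hl.2]
  refine (pow_left_inj₀ (by positivity) (by positivity) (four_ne_zero)).1 ?_
  have p1 : ∀ x : ℝ, 0 ≤ x → (x ^ ((1 : ℝ) / 4)) ^ 4 = x := fun x hx => by
    rw [← Real.rpow_natCast, ← Real.rpow_mul hx]; norm_num
  have p2 : (a ^ ((3 : ℝ) / 2)) ^ 4 = a ^ 6 := by
    rw [← Real.rpow_natCast, ← Real.rpow_mul ha.le, ← Real.rpow_natCast]; norm_num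
  have p3 : ∀ x : ℝ, 0 ≤ x → √x ^ 4 = x ^ 2 := fun x hx => by
    rw [show 4 = 2 * 2 from rfl, pow_mul, Real.sq_sqrt hx]
  have e1 : ∀ X : ℝ, (Real.pi⁻¹ * (2 * S * X)) ^ 4 = Real.pi⁻¹ ^ 4 * (2 ^ 4 * S ^ 4 * X ^ 4) :=
    fun X => by ring
  have e2 : ∀ X Y U V W : ℝ, (X * (Y * U * V / (l * W))) ^ 4 =
      X ^ 4 * (Y ^ 4 * (U ^ 4 * V ^ 4) / (l ^ 4 * W ^ 4)) := fun X Y U V W => by ring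
  rw [e1, e2, p1 u hu, p1 v hv, p2, p3 _ (by positivity), p3 _ (by positivity),
    p3 _ (by positivity)]
  have huv : u * v = 4 * l ^ 2 * a ^ 2 * S ^ 2 / (1 - l ^ 2) ^ 2 := by
    rw [hS2]; field_simp
  rw [huv]
  field_simp
  norm_num

/-- In the bulk region β < k/n < β^{−1} (with α₀ < β < 1) the Taylor
coefficients c_{n,k} of F_n(z) = (1−z²)·((z−λ)/(1−λz))ⁿ satisfy the stationary-phase bound
|c_{n,k}| ≤ √(2(1−λ²)/(πn))·(k/n − α₀)^{1/4}·(α₀^{−1} − k/n)^{1/4} / (λ·(k/n)^{3/2})·(1 + M/n). -/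
theorem coeff_bound_bulk_region
    (lam : ℝ) (hlam : lam ∈ Set.Ioo (0 : ℝ) 1)
    (alpha0 : ℝ) (halpha0 : alpha0 = (1 - lam) / (1 + lam))
    (beta : ℝ) (hbeta : beta ∈ Set.Ioo alpha0 1)
    (c : ℕ → ℕ → ℂ)
    (hc : ∀ n : ℕ, 1 ≤ n → ∀ z : ℂ, ‖z‖ < 1 →
      Summable (fun k : ℕ => c n k * z ^ k) ∧
      ∑' k : ℕ, c n k * z ^ k =
        (1 - z ^ 2) * ((z - (lam : ℂ)) / (1 - (lam : ℂ) * z)) ^ n) :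
    ∃ M : ℝ, 0 < M ∧ ∃ N : ℕ, ∀ n : ℕ, N ≤ n → ∀ k : ℕ,
      (beta < (k : ℝ) / n ∧ (k : ℝ) / n < beta⁻¹) →
      ‖c n k‖ ≤ Real.sqrt (2 * (1 - lam ^ 2) / (Real.pi * n)) *
        ((k : ℝ) / n - alpha0) ^ ((1 : ℝ) / 4) * (alpha0⁻¹ - (k : ℝ) / n) ^ ((1 : ℝ) / 4) /
          (lam * ((k : ℝ) / n) ^ ((3 : ℝ) / 2)) * (1 + M / n) := by
  obtain ⟨hl0, hl1⟩ := hlam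
  obtain ⟨hαβ, _⟩ := hbeta
  have hpi := Real.pi_pos
  have hκ : 0 < 1 - lam ^ 2 := by nlinarith
  have hα0 : 0 < alpha0 := by rw [halpha0]; exact div_pos (by linarith) (by linarith)
  have hβ0 : 0 < beta := hα0.trans hαβ
  have hinv : beta⁻¹ < alpha0⁻¹ := inv_strictAnti₀ hα0 hαβ
  have hu : 0 < beta - alpha0 := sub_pos.2 hαβ
  have hv : 0 < alpha0⁻¹ - beta⁻¹ := sub_pos.2 hinv
  set σ : ℝ := (1 - lam ^ 2) * beta / (2 * lam) * √((beta - alpha0) * (alpha0⁻¹ - beta⁻¹)) with hσ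
  have hσ0 : 0 < σ := by positivity
  obtain ⟨C, hC⟩ := norm_integral_blaschke_le ⟨hl0, hl1⟩ hσ0
  set ρ : ℝ := √(2 * (1 - lam ^ 2) / Real.pi) * (beta - alpha0) ^ ((1 : ℝ) / 4) *
    (alpha0⁻¹ - beta⁻¹) ^ ((1 : ℝ) / 4) / (lam * beta⁻¹ ^ ((3 : ℝ) / 2)) with hρ
  have hρ0 : 0 < ρ := by positivity
  have hsqrt : √(1 - lam ^ 2) < 1 := by
    rw [Real.sqrt_lt' one_pos]; nlinarith
  have hη : 0 < Real.pi * (ρ * (1 - √(1 - lam ^ 2))) := by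
    have := sub_pos.2 hsqrt
    positivity
  have ht0 : Tendsto (fun n : ℕ => (n : ℝ) ^ (-(1 / 10 : ℝ))) atTop (𝓝 0) :=
    (tendsto_rpow_neg_atTop (by norm_num)).comp tendsto_natCast_atTop_atTop
  have ev1 := ht0.eventually (gt_mem_nhds one_pos)
  have ev2 := (by simpa using ht0.pow 4 : Tendsto (fun n : ℕ =>
    ((n : ℝ) ^ (-(1 / 10 : ℝ))) ^ 4) atTop (𝓝 0)).eventually (gt_mem_nhds hσ0)
  have ev3 := (by simpa using ht0.const_mul C : Tendsto (fun n : ℕ =>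
    C * (n : ℝ) ^ (-(1 / 10 : ℝ))) atTop (𝓝 0)).eventually (gt_mem_nhds hη)
  obtain ⟨N, hN⟩ := eventually_atTop.1 (ev1.and (ev2.and (ev3.and (eventually_ge_atTop 1))))
  refine ⟨1, one_pos, N, fun n hn k ⟨hk1, hk2⟩ => ?_⟩
  obtain ⟨ht1, htσ, htC, hn1⟩ := hN n hn
  have hn0 : (0 : ℝ) < n := by exact_mod_cast hn1
  set t : ℝ := (n : ℝ) ^ (-(1 / 10 : ℝ)) with ht
  have htpos : 0 < t := Real.rpow_pos_of_pos hn0 _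
  have hnt : (n : ℝ) = (t ^ 10)⁻¹ := by
    rw [ht, ← Real.rpow_natCast, ← Real.rpow_mul hn0.le]
    norm_num [Real.rpow_neg_one]
  set a : ℝ := (k : ℝ) / n with ha
  have ha0 : 0 < a := hβ0.trans hk1
  have hua : 0 < a - alpha0 := by linarith
  have hva : 0 < alpha0⁻¹ - a := by linarith
  obtain ⟨θ, hθmem, hD, hsin2⟩ := exists_stationary_angle ⟨hl0, hl1⟩ halpha0 ha0 hua.le hva.le
  have hsin0 : 0 ≤ Real.sin θ := Real.sin_nonneg_of_mem_Icc hθmem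
  have hσsin : σ ≤ Real.sin θ := by
    refine (pow_le_pow_iff_left₀ hσ0.le hsin0 two_ne_zero).1 ?_
    rw [hsin2, hσ, mul_pow, Real.sq_sqrt (by positivity)]
    have h1 : beta ^ 2 ≤ (a ^ 2)⁻¹ := by
      rw [← inv_pow]
      have : beta ≤ a⁻¹ := (le_inv_comm₀ hβ0 ha0).2 hk2.le
      gcongr
    calc _ = (1 - lam ^ 2) ^ 2 / (4 * lam ^ 2) * beta ^ 2 *
          ((beta - alpha0) * (alpha0⁻¹ - beta⁻¹)) := by ring
      _ ≤ (1 - lam ^ 2) ^ 2 / (4 * lam ^ 2) * (a ^ 2)⁻¹ *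
          ((a - alpha0) * (alpha0⁻¹ - a)) := by gcongr
      _ = _ := by ring
  have hbound := hC n k θ hθmem t htpos ht1.le htσ.le hnt hσsin (by
    rw [hD, div_div_cancel₀ hκ.ne'])
  have hcoeff := norm_coeff_le_norm_integral_blaschke ⟨hl0, hl1⟩
    (fun z hz => (hc n hn1 z hz).2 ▸ (hc n hn1 z hz).1.hasSum) k
  rw [hD] at hbound
  set R : ℝ := √(2 * (1 - lam ^ 2) / (Real.pi * n)) * (a - alpha0) ^ ((1 : ℝ) / 4) *
    (alpha0⁻¹ - a) ^ ((1 : ℝ) / 4) / (lam * a ^ ((3 : ℝ) / 2)) with hR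
  have hamp := stationary_amplitude_eq ⟨hl0, hl1⟩ ha0 hua.le hva.le hn0 (hσ0.trans_le hσsin) hsin2
  rw [← hR] at hamp
  have hRρ : ρ * t ^ 5 ≤ R := by
    have h1 : √(2 * (1 - lam ^ 2) / (Real.pi * n)) = √(2 * (1 - lam ^ 2) / Real.pi) * t ^ 5 := by
      rw [← Real.sqrt_sq (by positivity : 0 ≤ t ^ 5), ← Real.sqrt_mul (by positivity), hnt]
      congr 1
      field_simp
    rw [hR, h1, hρ]
    calc _ = √(2 * (1 - lam ^ 2) / Real.pi) * t ^ 5 * (beta - alpha0) ^ ((1 : ℝ) / 4) *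
          (alpha0⁻¹ - beta⁻¹) ^ ((1 : ℝ) / 4) / (lam * beta⁻¹ ^ ((3 : ℝ) / 2)) := by ring
      _ ≤ _ := by gcongr
  have hR0 : 0 ≤ R := le_trans (by positivity) hRρ
  have herr : Real.pi⁻¹ * (C * t ^ 6) ≤ R * (1 - √(1 - lam ^ 2)) := by
    have h1 := sub_pos.2 hsqrt
    calc _ = Real.pi⁻¹ * (C * t) * t ^ 5 := by ring
      _ ≤ Real.pi⁻¹ * (Real.pi * (ρ * (1 - √(1 - lam ^ 2)))) * t ^ 5 := by gcongr
      _ = ρ * t ^ 5 * (1 - √(1 - lam ^ 2)) := by field_simp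
      _ ≤ _ := by gcongr
  have hfin : ‖c n k‖ ≤ R := by
    refine hcoeff.trans ((mul_le_mul_of_nonneg_left hbound (by positivity)).trans ?_)
    rw [mul_add, hamp]
    linarith
  refine hfin.trans (le_mul_of_one_le_right hR0 ?_)
  have : 0 < 1 / (n : ℝ) := by positivity
  linarith
end
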